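/- arXiv:1711.05933 — 2 statements merged into one kernel-verified Lean document; each statement's English description precedes it below -/
import Mathlib

section
/- If A = Z (that is, H ∩ K = [H,H] ∩ [K,K]), then there is a subgroup N of H²(H/Z, D) ⊕ H²(K/Z, D) with N ≅ Hom(Z, D) such that H²(G, D) ≅ ((H²(H/Z, D) ⊕ H²(K/Z, D))/N) ⊕ Hom(H/Z ⊗ K/Z, D). -/
/-!
Setting (central products): `G` is a group with normal subgroups `H` and `K` such that
`G = HK` (i.e. `H ⊔ K = ⊤`) and `[H, K] = 1` (i.e. every element of `H` commutes with
every element of `K`).  We set `A = H ⊓ K` and `Z = ⁅H,H⁆ ⊓ ⁅K,K⁆`; both are central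
in `G`.  Coefficients are taken in a divisible abelian group `D`, regarded as a trivial
module.  Second cohomology `H2 X D` is realized concretely as (inhomogeneous)
2-cocycles modulo 2-coboundaries, and `Hom(X, D)` is realized as `Additive X →+ D`.
-/

open scoped TensorProduct

set_option maxHeartbeats 1000000
set_option synthInstance.maxHeartbeats 1000000
set_option synthInstance.maxSize 2000

namespace SchurCP

variable (G : Type) [Group G] (D : Type) [AddCommGroup D]

/-- The group of 2-cocycles on `G` with values in the trivial module `D`. -/
def cocycles2 : AddSubgroup (G → G → D) where
  carrier := {f | ∀ g h k : G, f g h + f (g * h) k = f h k + f g (h * k)}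
  zero_mem' := by intro g h k; simp
  add_mem' := by
    intro a b ha hb g h k
    simp only [Pi.add_apply]
    rw [add_add_add_comm, ha g h k, hb g h k, add_add_add_comm]
  neg_mem' := by
    intro a ha g h k
    simp only [Pi.neg_apply]
    rw [← neg_add, ← neg_add, ha g h k]

/-- The group of 2-coboundaries on `G` with values in the trivial module `D`. -/
def coboundaries2 : AddSubgroup (G → G → D) where
  carrier := {f | ∃ φ : G → D, ∀ g h : G, f g h = φ g + φ h - φ (g * h)}
  zero_mem' := ⟨0, by simp⟩
  add_mem' := by
    rintro a b ⟨φ, hφ⟩ ⟨ψ, hψ⟩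
    exact ⟨φ + ψ, fun g h => by simp only [Pi.add_apply, hφ g h, hψ g h]; abel⟩
  neg_mem' := by
    rintro a ⟨φ, hφ⟩
    exact ⟨-φ, fun g h => by simp only [Pi.neg_apply, hφ g h]; abel⟩

/-- The second cohomology group `H²(G, D)` of `G` with coefficients in the
trivial module `D`. -/
def H2 : Type := cocycles2 G D ⧸ (coboundaries2 G D).addSubgroupOf (cocycles2 G D)

instance : AddCommGroup (H2 G D) :=
  QuotientAddGroup.Quotient.addCommGroup ((coboundaries2 G D).addSubgroupOf (cocycles2 G D))

variable {G D}

/-- The cohomology class of a 2-cocycle. -/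
abbrev H2mk (f : cocycles2 G D) : H2 G D := QuotientAddGroup.mk f

/-- Pullback of a 2-cocycle along a group homomorphism. -/
def pullCocycle {G' : Type} [Group G'] (π : G' →* G) :
    cocycles2 G D →+ cocycles2 G' D where
  toFun f := ⟨fun x y => (f : G → G → D) (π x) (π y), by
    intro x y z
    simpa only [map_mul] using f.2 (π x) (π y) (π z)⟩
  map_zero' := rfl
  map_add' _ _ := rfl

/-- The homomorphism `H²(G, D) → H²(G', D)` induced by a group homomorphism
`π : G' → G`; this specializes to restriction maps (for inclusions of subgroups)
and to inflation maps (for quotient maps). -/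
def H2Map {G' : Type} [Group G'] (π : G' →* G) : H2 G D →+ H2 G' D :=
  QuotientAddGroup.map _ _ (pullCocycle π) (by
    intro f hf
    rw [AddSubgroup.mem_addSubgroupOf] at hf
    rw [AddSubgroup.mem_comap, AddSubgroup.mem_addSubgroupOf]
    obtain ⟨φ, hφ⟩ := hf
    exact ⟨fun x => φ (π x), fun x y => by
      show (f : G → G → D) (π x) (π y) = _
      rw [hφ (π x) (π y), ← map_mul]⟩)

theorem commutator_le_self {X : Type} [Group X] (H : Subgroup X) : ⁅H, H⁆ ≤ H := by
  rw [Subgroup.commutator_le]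
  intro g₁ h₁ g₂ h₂
  rw [commutatorElement_def]
  exact H.mul_mem (H.mul_mem (H.mul_mem h₁ h₂) (H.inv_mem h₁)) (H.inv_mem h₂)

theorem inf_commutator_le_inf {X : Type} [Group X] (H K : Subgroup X) :
    ⁅H, H⁆ ⊓ ⁅K, K⁆ ≤ H ⊓ K :=
  inf_le_inf (commutator_le_self H) (commutator_le_self K)

theorem subgroupOf_le {X : Type} [Group X] {B C : Subgroup X} (h : B ≤ C)
    (J : Subgroup X) : B.subgroupOf J ≤ C.subgroupOf J := fun _x hx => h hx

/-- The natural projection `X/N → X/M` for `N ≤ M`. -/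
def quotProj {X : Type} [Group X] {N M : Subgroup X} [N.Normal] [M.Normal] (h : N ≤ M) :
    (X ⧸ N) →* (X ⧸ M) :=
  QuotientGroup.map N M (MonoidHom.id X) (by rwa [Subgroup.comap_id])

/-- The inflation homomorphism `H²(X/M, D) → H²(X/N, D)` for `N ≤ M`. -/
def inflMap {X : Type} [Group X] {N M : Subgroup X} [N.Normal] [M.Normal]
    (h : N ≤ M) (D : Type) [AddCommGroup D] : H2 (X ⧸ M) D →+ H2 (X ⧸ N) D :=
  H2Map (quotProj h)

/-- The natural homomorphism `H/(A ∩ H) → X/A` for subgroups `A, H` of `X`;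
for `A ≤ H` this realizes `H/A` as a subgroup of `X/A`. -/
def quotInclusion {X : Type} [Group X] (H A : Subgroup X) [A.Normal]
    [(A.subgroupOf H).Normal] : (↥H ⧸ A.subgroupOf H) →* X ⧸ A :=
  QuotientGroup.map (A.subgroupOf H) A H.subtype (fun _x hx => hx)

/-- The abelian tensor product `X ⊗ Y = X/[X,X] ⊗_ℤ Y/[Y,Y]` of two groups. -/
abbrev AbTensor (X Y : Type) [Group X] [Group Y] : Type :=
  TensorProduct ℤ (Additive (Abelianization X)) (Additive (Abelianization Y))

/-- The element `x[X,X] ⊗ y[Y,Y]` of the abelian tensor product. -/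
noncomputable abbrev tmulAb {X Y : Type} [Group X] [Group Y] (x : X) (y : Y) :
    AbTensor X Y :=
  Additive.ofMul (Abelianization.of x) ⊗ₜ[ℤ] Additive.ofMul (Abelianization.of y)

/-- The map on abelian tensor products induced by a pair of group homomorphisms. -/
noncomputable def abTensorMap {X Y X' Y' : Type} [Group X] [Group Y] [Group X'] [Group Y']
    (f : X →* X') (g : Y →* Y') : AbTensor X Y →ₗ[ℤ] AbTensor X' Y' :=
  TensorProduct.map (MonoidHom.toAdditive (Abelianization.map f)).toIntLinearMap
    (MonoidHom.toAdditive (Abelianization.map g)).toIntLinearMap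

/-! ### Surjections onto a product of two groups with central kernel -/

/-- A pair of homomorphisms `p : E → P`, `q : E → Q` whose common kernel `C` is central,
together with set-theoretic sections of `p` on `ker q` and of `q` on `ker p`. -/
structure CentralCover (E P Q : Type) [Group E] [Group P] [Group Q] where
  p : E →* P
  q : E →* Q
  S : P → E
  U : Q → E
  p_S : ∀ x, p (S x) = x
  q_S : ∀ x, q (S x) = 1
  p_U : ∀ y, p (U y) = 1
  q_U : ∀ y, q (U y) = y
  C : Subgroup E
  mem_C : ∀ g, g ∈ C ↔ p g = 1 ∧ q g = 1
  central : ∀ z ∈ C, ∀ g, Commute z g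

namespace CentralCover

variable {E P Q : Type} [Group E] [Group P] [Group Q]

/-- Exchange the roles of the two projections. -/
def swap (c : CentralCover E P Q) : CentralCover E Q P where
  p := c.q
  q := c.p
  S := c.U
  U := c.S
  p_S := c.q_U
  q_S := c.p_U
  p_U := c.q_S
  q_U := c.p_S
  C := c.C
  mem_C g := (c.mem_C g).trans and_comm
  central := c.central

variable (c : CentralCover E P Q)

/-- The factor set of the section `S`. -/
def factor (x x' : P) : c.C :=
  ⟨c.S x * c.S x' * (c.S (x * x'))⁻¹, by
    rw [c.mem_C]; simp [c.p_S, c.q_S]⟩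

theorem S_mul (x x' : P) : c.S x * c.S x' = c.factor x x' * c.S (x * x') := by
  simp [factor]

/-- The commutator of `S x` and `U y`. -/
def comm (x : P) (y : Q) : c.C :=
  ⟨c.S x * c.U y * (c.S x)⁻¹ * (c.U y)⁻¹, by
    rw [c.mem_C]; simp [c.p_S, c.q_S, c.p_U, c.q_U]⟩

/-- The factor set of the section `U`. -/
def cofactor (y y' : Q) : c.C := c.swap.factor y y'

theorem S_mul_U (x : P) (y : Q) : c.S x * c.U y = c.comm x y * (c.U y * c.S x) := by
  simp [comm, mul_assoc]

/-- The component in `C` of an element of `E`. -/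
def zpart (e : E) : c.C :=
  ⟨(c.U (c.q e) * c.S (c.p e))⁻¹ * e, by
    rw [c.mem_C]; simp [c.p_S, c.q_S, c.p_U, c.q_U]⟩

theorem zpart_mul' (e : E) : c.zpart e * (c.U (c.q e) * c.S (c.p e)) = e := by
  rw [(c.central _ (c.zpart e).2 _).eq, zpart, mul_inv_cancel_left]

theorem left_comm_C (z : c.C) (g h : E) : g * (z * h) = z * (g * h) := by
  rw [← mul_assoc, ← (c.central _ z.2 g).eq, mul_assoc]

theorem C_left_comm (z w : c.C) (g : E) : (z : E) * (w * g) = w * (z * g) :=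
  c.left_comm_C w z g

theorem C_comm (z w : c.C) : z * w = w * z := Subtype.ext (c.central _ z.2 w).eq

theorem factor_cocycle (x y w : P) :
    c.factor x y * c.factor (x * y) w = c.factor y w * c.factor x (y * w) := by
  have h1 : c.S x * c.S y * c.S w =
      (c.factor x y * c.factor (x * y) w : E) * c.S (x * y * w) := by
    rw [S_mul, mul_assoc, S_mul, ← mul_assoc]
  have h2 : c.S x * c.S y * c.S w =
      (c.factor y w * c.factor x (y * w) : E) * c.S (x * y * w) := by
    rw [mul_assoc, S_mul, left_comm_C, S_mul, ← mul_assoc, mul_assoc x y w]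
  exact Subtype.ext (mul_right_cancel (h1.symm.trans h2))

theorem comm_mul_left (x x' : P) (y : Q) :
    c.comm (x * x') y = c.comm x y * c.comm x' y := by
  have h1 : c.S x * c.S x' * c.U y =
      (c.factor x x' * c.comm (x * x') y : E) * (c.U y * c.S (x * x')) := by
    rw [S_mul, mul_assoc, S_mul_U, mul_assoc]
  have h2 : c.S x * c.S x' * c.U y =
      (c.comm x' y * c.comm x y * c.factor x x' : E) * (c.U y * c.S (x * x')) := by
    rw [mul_assoc, S_mul_U, left_comm_C, ← mul_assoc (c.S x), S_mul_U, mul_assoc, mul_assoc,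
      S_mul, c.left_comm_C (c.factor x x') (c.U y)]
    simp only [mul_assoc, C_left_comm]
  have h3 := Subtype.ext (mul_right_cancel (h1.symm.trans h2)) (a1 := c.factor x x' * _)
    (a2 := c.comm x' y * c.comm x y * c.factor x x')
  rw [C_comm, C_comm c (c.comm x' y)] at h3
  exact mul_right_cancel h3

theorem comm_swap (x : P) (y : Q) : c.swap.comm y x = (c.comm x y)⁻¹ := by
  apply Subtype.ext
  simp [comm, swap, mul_assoc]

theorem comm_mul_right (x : P) (y y' : Q) :
    c.comm x (y * y') = c.comm x y * c.comm x y' := by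
  have h := c.swap.comm_mul_left y y' x
  simp only [comm_swap] at h
  rw [← inv_inj, h, mul_inv_rev, C_comm]
  rfl

theorem zpart_mul (e e' : E) :
    c.zpart (e * e') = c.cofactor (c.q e) (c.q e') * c.factor (c.p e) (c.p e') *
      c.comm (c.p e) (c.q e') * c.zpart e * c.zpart e' := by
  have h1 := c.zpart_mul' (e * e')
  rw [map_mul, map_mul] at h1
  have hU : c.U (c.q e) * c.U (c.q e') =
    c.cofactor (c.q e) (c.q e') * c.U (c.q e * c.q e') := c.swap.S_mul _ _
  have h2 : e * e' = (c.cofactor (c.q e) (c.q e') * c.factor (c.p e) (c.p e') *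
      c.comm (c.p e) (c.q e') * c.zpart e * c.zpart e' : E) *
      (c.U (c.q e * c.q e') * c.S (c.p e * c.p e')) := by
    have e1 : c.U (c.q e) * c.S (c.p e) * (c.U (c.q e') * c.S (c.p e')) =
      (c.comm (c.p e) (c.q e') * (c.cofactor (c.q e) (c.q e') *
        (c.factor (c.p e) (c.p e') * (c.U (c.q e * c.q e') * c.S (c.p e * c.p e'))) : E)) := by
      rw [mul_assoc, ← mul_assoc (c.S _), S_mul_U, mul_assoc (c.comm _ _ : E), left_comm_C,
        mul_assoc (c.U _) (c.S _), S_mul, c.left_comm_C _ (c.U (c.q e')),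
        c.left_comm_C _ (c.U (c.q e)), ← mul_assoc (c.U _) (c.U _), hU]
      simp only [mul_assoc, C_left_comm]
    conv_lhs => rw [← c.zpart_mul' e, ← c.zpart_mul' e']
    rw [mul_assoc, left_comm_C, e1]
    simp only [mul_assoc, C_left_comm]
  exact Subtype.ext (mul_right_cancel (h1.trans h2))

end CentralCover

/-! ### Bimultiplicative maps and the abelian tensor product -/

section Tensor

variable {P Q D : Type} [Group P] [Group Q] [AddCommGroup D]

theorem tmulAb_mul_left (x x' : P) (y : Q) : tmulAb (x * x') y = tmulAb x y + tmulAb x' y := by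
  simp only [tmulAb, map_mul, ofMul_mul, TensorProduct.add_tmul]

theorem tmulAb_mul_right (x : P) (y y' : Q) : tmulAb x (y * y') = tmulAb x y + tmulAb x y' := by
  simp only [tmulAb, map_mul, ofMul_mul, TensorProduct.tmul_add]

theorem tmulAb_one_left (y : Q) : tmulAb (1 : P) y = 0 := by
  simp only [tmulAb, map_one, ofMul_one, TensorProduct.zero_tmul]

/-- A bimultiplicative map induces a homomorphism on the abelian tensor product. -/
theorem exists_abTensor_lift (b : P → Q → D)
    (hl : ∀ x x' y, b (x * x') y = b x y + b x' y)
    (hr : ∀ x y y', b x (y * y') = b x y + b x y') :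
    ∃ t : AbTensor P Q →+ D, ∀ x y, t (tmulAb x y) = b x y := by
  let b₁ (x : P) : Additive (Abelianization Q) →+ D :=
    MonoidHom.toAdditiveLeft (Abelianization.lift
      (MonoidHom.mk' (fun y => Multiplicative.ofAdd (b x y)) (fun y y' => by rw [hr]; rfl)))
  have hb₁ (x : P) (y : Q) : b₁ x (Additive.ofMul (Abelianization.of y)) = b x y := rfl
  have hb₁_mul (x x' : P) : b₁ (x * x') = b₁ x + b₁ x' := by
    refine AddMonoidHom.ext fun y => ?_
    obtain ⟨y, rfl⟩ := QuotientGroup.mk_surjective y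
    exact hl x x' y
  let b₂ : Additive (Abelianization P) →+ Additive (Abelianization Q) →+ D :=
    MonoidHom.toAdditiveLeft (Abelianization.lift
      (MonoidHom.mk' (fun x => Multiplicative.ofAdd (b₁ x)) (fun x x' => by rw [hb₁_mul]; rfl)))
  exact ⟨TensorProduct.liftAddHom b₂ (fun r m n => by
    rw [map_zsmul, map_zsmul, AddMonoidHom.zsmul_apply]), fun x y => rfl⟩

theorem abTensor_hom_eq_zero (t : AbTensor P Q →+ D) (h : ∀ x y, t (tmulAb x y) = 0) : t = 0 := by
  ext w
  induction w using TensorProduct.induction_on with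
  | zero => simp
  | tmul x y =>
    obtain ⟨x, rfl⟩ := QuotientGroup.mk_surjective x
    obtain ⟨y, rfl⟩ := QuotientGroup.mk_surjective y
    exact h x y
  | add x y hx hy => rw [map_add, hx, hy]; simp

/-- The cup product of a homomorphism on `P ⊗ Q` along projections to `P` and `Q`. -/
noncomputable def cupCocycle {G : Type} [Group G] (p : G →* P) (q : G →* Q) :
    (AbTensor P Q →+ D) →+ cocycles2 G D where
  toFun t := ⟨fun x y => t (tmulAb (p x) (q y)), by
    intro x y z
    simp only [map_mul, tmulAb_mul_left, tmulAb_mul_right, map_add]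
    abel⟩
  map_zero' := rfl
  map_add' _ _ := rfl

end Tensor

section Cocycle

variable {G D : Type} [Group G] [AddCommGroup D]

theorem H2mk_eq_zero (f : cocycles2 G D) : H2mk f = 0 ↔ (f : G → G → D) ∈ coboundaries2 G D :=
  (QuotientAddGroup.eq_zero_iff f).trans AddSubgroup.mem_addSubgroupOf

theorem cocycles2_one_left (f : cocycles2 G D) (g : G) : f.1 1 g = f.1 1 1 := by
  have := f.2 1 1 g
  simp only [one_mul] at this
  exact (add_right_cancel (this.trans (add_comm _ _)).symm)

theorem cocycles2_one_right (f : cocycles2 G D) (g : G) : f.1 g 1 = f.1 1 1 := by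
  have := f.2 g 1 1
  simp only [mul_one] at this
  exact add_right_cancel this

/-- A map which is additive on a subgroup vanishes on its commutator subgroup. -/
theorem eq_zero_of_mem_commutator {L : Subgroup G} {ψ : G → D}
    (hψ : ∀ x ∈ L, ∀ y ∈ L, ψ (x * y) = ψ x + ψ y) {z : G} (hz : z ∈ ⁅L, L⁆) : ψ z = 0 := by
  let ψ' : L →* Multiplicative D :=
    MonoidHom.mk' (fun x => Multiplicative.ofAdd (ψ x)) (fun x y => hψ x x.2 y y.2)
  have h : ⁅L, L⁆ ≤ ψ'.ker.map L.subtype := by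
    rw [Subgroup.commutator_le]
    intro a ha b hb
    refine ⟨⟨a, ha⟩ * ⟨b, hb⟩ * ⟨a, ha⟩⁻¹ * ⟨b, hb⟩⁻¹, ?_, rfl⟩
    rw [SetLike.mem_coe, MonoidHom.mem_ker, map_mul, map_mul, map_mul, map_inv, map_inv,
      mul_inv_cancel_comm, mul_inv_cancel]
  obtain ⟨w, hw, rfl⟩ := h hz
  exact hw

end Cocycle

namespace CentralCover

variable {E P Q D : Type} [Group E] [Group P] [Group Q] [AddCommGroup D]
variable (c : CentralCover E P Q)

/-- Push the factor set of `S` forward along homomorphisms `C → D`. -/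
def transgression : (Additive c.C →+ D) →+ cocycles2 P D where
  toFun χ := ⟨fun x y => χ (Additive.ofMul (c.factor x y)), by
    intro x y w
    simp only [← map_add, ← ofMul_mul, factor_cocycle]⟩
  map_zero' := rfl
  map_add' _ _ := rfl

theorem zpart_mul_factor_one (z : c.C) :
    c.zpart z * c.cofactor 1 1 * c.factor 1 1 = z := by
  have h := c.zpart_mul' z
  rw [((c.mem_C z).1 z.2).1, ((c.mem_C z).1 z.2).2] at h
  apply Subtype.ext
  simpa [cofactor, swap, factor, mul_assoc] using h

theorem transgression_injective (hC : c.C ≤ ⁅c.q.ker, c.q.ker⁆) (χ : Additive c.C →+ D)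
    (h : (c.transgression χ : P → P → D) ∈ coboundaries2 P D) : χ = 0 := by
  obtain ⟨φ, hφ⟩ := h
  have hφ' (x y) : χ (Additive.ofMul (c.factor x y)) = φ x + φ y - φ (x * y) := hφ x y
  have hcomm (x : P) : c.comm x 1 = 1 := by
    have := c.comm_mul_right x 1 1
    rwa [mul_one, left_eq_mul] at this
  have hψ : ∀ g ∈ c.q.ker, ∀ g' ∈ c.q.ker,
      χ (.ofMul (c.zpart (g * g'))) + χ (.ofMul (c.cofactor 1 1)) + φ (c.p (g * g')) =
      χ (.ofMul (c.zpart g)) + χ (.ofMul (c.cofactor 1 1)) + φ (c.p g) +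
      (χ (.ofMul (c.zpart g')) + χ (.ofMul (c.cofactor 1 1)) + φ (c.p g')) := by
    intro g hg g' hg'
    rw [MonoidHom.mem_ker] at hg hg'
    rw [zpart_mul, hg, hg', hcomm, map_mul c.p]
    simp only [ofMul_mul, map_add, ofMul_one, map_zero, hφ']
    abel
  refine AddMonoidHom.ext fun z => ?_
  have hz := (c.mem_C z.toMul).1 z.toMul.2
  have h0 := eq_zero_of_mem_commutator
    (ψ := fun g => χ (.ofMul (c.zpart g)) + χ (.ofMul (c.cofactor 1 1)) + φ (c.p g))
    hψ (hC z.toMul.2)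
  have h1 : z = .ofMul (c.zpart z.toMul) + .ofMul (c.cofactor 1 1) + .ofMul (c.factor 1 1) :=
    congrArg Additive.ofMul (c.zpart_mul_factor_one z.toMul).symm
  have h2 := hφ' 1 1
  rw [mul_one, add_sub_cancel_right] at h2
  rw [hz.1, ← h2, ← map_add, ← map_add, ← h1] at h0
  exact h0

/-- Modulo a coboundary, the factor sets of the two sections and their commutator pairing
cancel after pushing forward to `D`. -/
theorem exists_decomposition (χ : Additive c.C →+ D) :
    ∃ t : AbTensor P Q →+ D, (∀ x y, t (tmulAb x y) = χ (Additive.ofMul (c.comm x y))) ∧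
      ∀ e e' : E, χ (Additive.ofMul (c.zpart (e * e'))) =
        (c.swap.transgression χ).1 (c.q e) (c.q e') + (c.transgression χ).1 (c.p e) (c.p e') +
        t (tmulAb (c.p e) (c.q e')) +
        χ (Additive.ofMul (c.zpart e)) + χ (Additive.ofMul (c.zpart e')) := by
  obtain ⟨t, ht⟩ := exists_abTensor_lift (fun x y => χ (Additive.ofMul (c.comm x y)))
    (fun x x' y => by rw [comm_mul_left, ofMul_mul, map_add])
    (fun x y y' => by rw [comm_mul_right, ofMul_mul, map_add])
  refine ⟨t, ht, fun e e' => ?_⟩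
  rw [ht, zpart_mul]
  simp only [ofMul_mul, map_add]
  rfl

end CentralCover

/-! ### The extension defined by a cocycle -/

/-- The underlying set of the central extension of `G` by `D` defined by a cocycle. -/
structure Twisted {G D : Type} [Group G] [AddCommGroup D] (f : cocycles2 G D) where
  fiber : D
  base : G

namespace Twisted

variable {G D : Type} [Group G] [AddCommGroup D] (f : cocycles2 G D)

instance : Mul (Twisted f) := ⟨fun a b => ⟨a.fiber + b.fiber + f.1 a.base b.base, a.base * b.base⟩⟩

instance : One (Twisted f) := ⟨⟨-f.1 1 1, 1⟩⟩

instance : Inv (Twisted f) :=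
  ⟨fun a => ⟨-a.fiber - f.1 a.base⁻¹ a.base - f.1 1 1, a.base⁻¹⟩⟩

variable {f}

theorem mk_mul_mk (a b : D) (g h : G) :
    (⟨a, g⟩ * ⟨b, h⟩ : Twisted f) = ⟨a + b + f.1 g h, g * h⟩ := rfl

theorem one_def : (1 : Twisted f) = ⟨-f.1 1 1, 1⟩ := rfl

instance : Group (Twisted f) :=
  Group.ofLeftAxioms
    (by
      rintro ⟨a, g⟩ ⟨b, h⟩ ⟨d, k⟩
      simp only [mk_mul_mk, mul_assoc]
      congr 1
      rw [add_right_comm (a + b), add_assoc (a + b + d), f.2 g h k]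
      abel)
    (by
      rintro ⟨a, g⟩
      rw [one_def, mk_mul_mk, one_mul, cocycles2_one_left f g, add_right_comm,
        neg_add_cancel, zero_add])
    (by
      rintro ⟨a, g⟩
      change (⟨_, _⟩ : Twisted f) = ⟨_, _⟩
      congr 1
      · change -a - f.1 g⁻¹ g - f.1 1 1 + a + f.1 g⁻¹ g = -f.1 1 1
        abel
      · exact inv_mul_cancel g)

variable (f) in
/-- The projection of the extension onto `G`. -/
def proj : Twisted f →* G := MonoidHom.mk' base fun _ _ => rfl

theorem commute_mk_iff {a b : D} {g h : G} :
    Commute (⟨a, g⟩ : Twisted f) ⟨b, h⟩ ↔ Commute g h ∧ f.1 g h = f.1 h g := by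
  rw [Commute, SemiconjBy, mk_mul_mk, mk_mul_mk, Twisted.mk.injEq, add_comm b a, and_comm,
    add_right_inj]
  rfl

end Twisted

/-- The commutator pairing of a cocycle is additive on elements commuting with a given one. -/
theorem cocycles2_antisymm_mul {G D : Type} [Group G] [AddCommGroup D] (f : cocycles2 G D)
    {h k k' : G} (hk : Commute h k) (hk' : Commute h k') :
    f.1 h (k * k') - f.1 (k * k') h = f.1 h k - f.1 k h + (f.1 h k' - f.1 k' h) := by
  have e1 := f.2 h k k'
  have e2 := f.2 k k' h
  have e3 := f.2 k h k'
  rw [← hk'.eq] at e2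
  rw [← hk.eq] at e3
  linear_combination (norm := module) e3 - e1 - e2

/-- A divisible subgroup of a commutative group is a retract. -/
theorem exists_retraction {C D : Type} [Group C] (hC : ∀ a b : C, a * b = b * a)
    [AddCommGroup D] [DivisibleBy D ℤ] (i : D →+ Additive C) (hi : Function.Injective i) :
    ∃ r : Additive C →+ D, ∀ d, r (i d) = d := by
  let _ : CommGroup C := { mul_comm := hC }
  obtain ⟨r, hr⟩ := Module.Baer.extension_property_addMonoidHom (Module.Baer.of_divisible D)
    i hi (AddMonoidHom.id D)
  exact ⟨r, DFunLike.congr_fun hr⟩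

namespace CentralCover

variable {G P Q D : Type} [Group G] [Group P] [Group Q] [AddCommGroup D]
variable (c : CentralCover G P Q)

theorem zpart_C_mul (z : c.C) (g : G) : c.zpart (z * g) = z * c.zpart g := by
  apply Subtype.ext
  have hz := (c.mem_C z).1 z.2
  simp only [zpart, map_mul, hz.1, hz.2, one_mul, Subgroup.coe_mul, left_comm_C]

theorem exists_ker_mul_ker (g : G) : ∃ h ∈ c.q.ker, ∃ k ∈ c.p.ker, h * k = g :=
  ⟨c.S (c.p g), c.q_S _, (c.S (c.p g))⁻¹ * g, by simp [MonoidHom.mem_ker, c.p_S],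
    mul_inv_cancel_left _ _⟩

theorem commute_twisted_of_mem_commutator (f : cocycles2 G D) {L : Subgroup G} {g z : G}
    (hL : ∀ x ∈ L, Commute g x) (hLL : ⁅L, L⁆ ≤ L) (hz : z ∈ ⁅L, L⁆) (a b : D) :
    Commute (⟨a, z⟩ : Twisted f) ⟨b, g⟩ := by
  refine Twisted.commute_mk_iff.2 ⟨(hL z (hLL hz)).symm, ?_⟩
  have h := eq_zero_of_mem_commutator (ψ := fun x => f.1 g x - f.1 x g)
    (fun x hx y hy => cocycles2_antisymm_mul f (hL x hx) (hL y hy)) hz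
  exact (sub_eq_zero.1 h).symm

theorem commute_twisted (hcomm : ∀ h ∈ c.q.ker, ∀ k ∈ c.p.ker, Commute h k)
    (hp : c.C ≤ ⁅c.p.ker, c.p.ker⁆) (hq : c.C ≤ ⁅c.q.ker, c.q.ker⁆)
    (f : cocycles2 G D) {z : G} (hz : z ∈ c.C) (a b : D) (g : G) :
    Commute (⟨a, z⟩ : Twisted f) ⟨b, g⟩ := by
  obtain ⟨h, hh, k, hk, rfl⟩ := c.exists_ker_mul_ker g
  have e : (⟨b, h * k⟩ : Twisted f) = ⟨b - f.1 h k, h⟩ * ⟨0, k⟩ := by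
    rw [Twisted.mk_mul_mk, add_zero, sub_add_cancel]
  rw [e]
  exact (commute_twisted_of_mem_commutator f (hcomm h hh)
    (commutator_le_self _) (hp hz) _ _).mul_right
    (commute_twisted_of_mem_commutator f (fun x hx => (hcomm x hx k hk).symm)
      (commutator_le_self _) (hq hz) _ _)

/-- The cover of `P × Q` by the extension of `G` attached to a cocycle. -/
def twisted (f : cocycles2 G D)
    (hf : ∀ z ∈ c.C, ∀ (a b : D) (g : G), Commute (⟨a, z⟩ : Twisted f) ⟨b, g⟩) :
    CentralCover (Twisted f) P Q where
  p := c.p.comp (Twisted.proj f)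
  q := c.q.comp (Twisted.proj f)
  S x := ⟨0, c.S x⟩
  U y := ⟨0, c.U y⟩
  p_S := c.p_S
  q_S := c.q_S
  p_U := c.p_U
  q_U := c.q_U
  C := c.C.comap (Twisted.proj f)
  mem_C g := c.mem_C (Twisted.proj f g)
  central := fun ⟨a, z⟩ hz ⟨b, g⟩ => hf z hz a b g

/-! ### The comparison map -/

/-- The pair of transgressions of a homomorphism on the central kernel. -/
def transgressionPair : (Additive c.C →+ D) →+ H2 P D × H2 Q D :=
  ((QuotientAddGroup.mk' _).comp c.transgression).prod
    ((QuotientAddGroup.mk' _).comp c.swap.transgression)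

theorem transgressionPair_injective (hq : c.C ≤ ⁅c.q.ker, c.q.ker⁆) :
    Function.Injective (c.transgressionPair (D := D)) := by
  rw [injective_iff_map_eq_zero]
  intro χ hχ
  exact c.transgression_injective hq χ ((H2mk_eq_zero _).1 (Prod.ext_iff.1 hχ).1)

/-- Inflation from `P` and `Q` together with the cup product. -/
noncomputable def comparison :
    (H2 P D × H2 Q D) × (AbTensor P Q →+ D) →+ H2 G D :=
  ((H2Map c.p).coprod (H2Map c.q)).coprod ((QuotientAddGroup.mk' _).comp (cupCocycle c.p c.q))

theorem comparison_mk (f : cocycles2 P D) (e : cocycles2 Q D) (t : AbTensor P Q →+ D) :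
    c.comparison ((H2mk f, H2mk e), t) =
      H2mk (pullCocycle c.p f + pullCocycle c.q e + cupCocycle c.p c.q t) := rfl

theorem comm_eq_one (hcomm : ∀ h ∈ c.q.ker, ∀ k ∈ c.p.ker, Commute h k) (x : P) (y : Q) :
    c.comm x y = 1 := by
  apply Subtype.ext
  simp only [comm, (hcomm _ (c.q_S x) _ (c.p_U y)).eq]
  simp

theorem comparison_transgressionPair (hcomm : ∀ h ∈ c.q.ker, ∀ k ∈ c.p.ker, Commute h k)
    (χ : Additive c.C →+ D) : c.comparison (c.transgressionPair χ, 0) = 0 := by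
  refine (c.comparison_mk (c.transgression χ) (c.swap.transgression χ) 0).trans
    ((H2mk_eq_zero _).2 ⟨fun g => -χ (.ofMul (c.zpart g)), fun g h => ?_⟩)
  obtain ⟨t, ht, hdec⟩ := c.exists_decomposition χ
  have hgh := hdec g h
  rw [ht, comm_eq_one c hcomm, ofMul_one, map_zero] at hgh
  change (c.transgression χ).1 (c.p g) (c.p _) + (c.swap.transgression χ).1 (c.q g) (c.q _) + 0 = _
  linear_combination (norm := module) hgh.symm

theorem comparison_surjective [DivisibleBy D ℤ]
    (hcomm : ∀ h ∈ c.q.ker, ∀ k ∈ c.p.ker, Commute h k)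
    (hp : c.C ≤ ⁅c.p.ker, c.p.ker⁆) (hq : c.C ≤ ⁅c.q.ker, c.q.ker⁆) :
    Function.Surjective (c.comparison (D := D)) := by
  intro w
  obtain ⟨f, rfl⟩ := QuotientAddGroup.mk_surjective w
  let c' := c.twisted f fun z hz a b g => c.commute_twisted hcomm hp hq f hz a b g
  let i : D →+ Additive c'.C := AddMonoidHom.mk'
    (fun d => .ofMul ⟨⟨d - f.1 1 1, 1⟩, c.C.one_mem⟩) (fun a b => by
      refine congrArg Additive.ofMul (Subtype.ext ?_)
      change _ = (⟨a - f.1 1 1 + (b - f.1 1 1) + f.1 1 1, 1 * 1⟩ : Twisted f)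
      rw [one_mul, sub_add_sub_comm, ← sub_sub, sub_add_cancel])
  have hi : Function.Injective i := fun a b hab =>
    sub_left_injective (congrArg (fun u : Additive c'.C => u.toMul.1.fiber) hab)
  obtain ⟨r, hr⟩ := exists_retraction c'.C_comm i hi
  obtain ⟨t, -, ht⟩ := c'.exists_decomposition r
  refine ⟨((H2mk (c'.transgression r), H2mk (c'.swap.transgression r)), t), ?_⟩
  refine (c.comparison_mk _ _ _).trans
    (sub_eq_zero.1 ((H2mk_eq_zero (pullCocycle c.p (c'.transgression r) +
      pullCocycle c.q (c'.swap.transgression r) + cupCocycle c.p c.q t - f)).2 ?_))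
  refine ⟨fun g => -r (.ofMul (c'.zpart ⟨0, g⟩)), fun g h => ?_⟩
  have h1 := ht ⟨0, g⟩ ⟨0, h⟩
  have h2 : c'.zpart (⟨0, g⟩ * ⟨0, h⟩) = (i (f.1 g h)).toMul * c'.zpart ⟨0, g * h⟩ := by
    rw [← c'.zpart_C_mul]
    congr 1
    change (⟨0 + 0 + f.1 g h, g * h⟩ : Twisted f) =
      ⟨f.1 g h - f.1 1 1 + 0 + f.1 1 (g * h), 1 * (g * h)⟩
    rw [one_mul, cocycles2_one_left f (g * h), add_zero, add_zero, zero_add, sub_add_cancel]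
  rw [h2, ofMul_mul, map_add, ofMul_toMul, hr] at h1
  change (c'.transgression r).1 (c.p g) (c.p h) + (c'.swap.transgression r).1 (c.q g) (c.q h)
    + t (tmulAb (c.p g) (c.q h)) - f.1 g h = _
  have h3 : f.1 g h + r (.ofMul (c'.zpart ⟨0, g * h⟩)) =
      (c'.swap.transgression r).1 (c.q g) (c.q h) + (c'.transgression r).1 (c.p g) (c.p h) +
      t (tmulAb (c.p g) (c.q h)) + r (.ofMul (c'.zpart ⟨0, g⟩)) +
      r (.ofMul (c'.zpart ⟨0, h⟩)) := h1
  linear_combination (norm := module) h3.symm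

theorem transgression_of_coboundary (f : cocycles2 P D) (κ : D) (φ : G → D)
    (h : ∀ g ∈ c.q.ker, ∀ g' ∈ c.q.ker,
      f.1 (c.p g) (c.p g') + κ = φ g + φ g' - φ (g * g'))
    (χ : Additive c.C →+ D) (hχ : ∀ z : c.C, χ (.ofMul z) = φ 1 - φ z) :
    (f - c.transgression χ : P → P → D) ∈ coboundaries2 P D := by
  refine ⟨fun x => φ (c.S x) - κ, fun x x' => ?_⟩
  have h1 := h _ (c.q_S x) _ (c.q_S x')
  have h2 := h _ ((c.mem_C _).1 (c.factor x x').2).2 _ (c.q_S (x * x'))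
  have h3 := h 1 (one_mem _) 1 (one_mem _)
  rw [c.S_mul, c.p_S, c.p_S] at h1
  rw [((c.mem_C _).1 (c.factor x x').2).1, cocycles2_one_left] at h2
  rw [mul_one, map_one] at h3
  change f.1 x x' - χ (.ofMul (c.factor x x')) = _
  rw [hχ]
  linear_combination (norm := module) h1 - h2 + h3

theorem ker_comparison (hcomm : ∀ h ∈ c.q.ker, ∀ k ∈ c.p.ker, Commute h k) :
    (c.comparison (D := D)).ker = c.transgressionPair.range.prod ⊥ := by
  ext ⟨⟨a, e⟩, t⟩
  obtain ⟨a, rfl⟩ := QuotientAddGroup.mk_surjective a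
  obtain ⟨e, rfl⟩ := QuotientAddGroup.mk_surjective e
  rw [AddMonoidHom.mem_ker, AddSubgroup.mem_prod, AddSubgroup.mem_bot, AddMonoidHom.mem_range]
  constructor
  · intro h
    rw [comparison_mk, H2mk_eq_zero] at h
    obtain ⟨φ, hφ⟩ := h
    replace hφ (g g' : G) : a.1 (c.p g) (c.p g') + e.1 (c.q g) (c.q g') +
      t (tmulAb (c.p g) (c.q g')) = φ g + φ g' - φ (g * g') := hφ g g'
    have ht : t = 0 := by
      refine abTensor_hom_eq_zero t fun x y => ?_
      have h1 := hφ (c.S x) (c.U y)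
      have h2 := hφ (c.U y) (c.S x)
      rw [(hcomm _ (c.q_S x) _ (c.p_U y)).eq, c.p_S, c.q_S, c.p_U, c.q_U,
        cocycles2_one_left, cocycles2_one_right] at h1
      rw [c.p_S, c.q_S, c.p_U, c.q_U, cocycles2_one_left, cocycles2_one_right e,
        tmulAb_one_left, map_zero] at h2
      linear_combination (norm := module) h1 - h2
    subst ht
    refine ⟨?_, rfl⟩
    replace hφ (g g' : G) : a.1 (c.p g) (c.p g') + e.1 (c.q g) (c.q g') =
      φ g + φ g' - φ (g * g') := by rw [← hφ, AddMonoidHom.zero_apply, add_zero]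
    have hφ₁ : a.1 1 1 + e.1 1 1 = φ 1 := by
      simpa using hφ 1 1
    let χ : Additive c.C →+ D := AddMonoidHom.mk' (fun z => φ 1 - φ z.toMul) (fun z w => by
      have h := hφ z.toMul w.toMul
      have hz := (c.mem_C _).1 z.toMul.2
      have hw := (c.mem_C _).1 w.toMul.2
      rw [hz.1, hz.2, hw.1, hw.2, hφ₁] at h
      rw [toMul_add, Subgroup.coe_mul]
      linear_combination (norm := module) h.symm)
    refine ⟨χ, Prod.ext ?_ ?_⟩
    · refine (sub_eq_zero.1 ((H2mk_eq_zero (a - c.transgression χ)).2 ?_)).symm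
      refine c.transgression_of_coboundary a (e.1 1 1) φ (fun g hg g' hg' => ?_) χ fun z => rfl
      rw [← hφ, hg, hg']
    · refine (sub_eq_zero.1 ((H2mk_eq_zero (e - c.swap.transgression χ)).2 ?_)).symm
      refine c.swap.transgression_of_coboundary e (a.1 1 1) φ (fun g hg g' hg' => ?_) χ fun z => rfl
      have hg₁ : c.p g = 1 := hg
      have hg₁' : c.p g' = 1 := hg'
      rw [← hφ, hg₁, hg₁', add_comm]
      rfl
  · rintro ⟨⟨χ, hχ⟩, ht⟩
    dsimp only at hχ ht
    rw [ht, ← hχ]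
    exact c.comparison_transgressionPair hcomm χ

theorem exists_H2_equiv [DivisibleBy D ℤ]
    (hcomm : ∀ h ∈ c.q.ker, ∀ k ∈ c.p.ker, Commute h k)
    (hp : c.C ≤ ⁅c.p.ker, c.p.ker⁆) (hq : c.C ≤ ⁅c.q.ker, c.q.ker⁆) :
    ∃ N : AddSubgroup (H2 P D × H2 Q D), Nonempty (N ≃+ (Additive c.C →+ D)) ∧
      Nonempty (H2 G D ≃+ ((H2 P D × H2 Q D) ⧸ N) × (AbTensor P Q →+ D)) := by
  refine ⟨c.transgressionPair.range,
    ⟨(AddMonoidHom.ofInjective (c.transgressionPair_injective hq)).symm⟩, ⟨?_⟩⟩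
  let π := (QuotientAddGroup.mk' (c.transgressionPair (D := D)).range).prodMap
    (AddMonoidHom.id (AbTensor P Q →+ D))
  have hπ : Function.Surjective π :=
    (QuotientAddGroup.mk'_surjective _).prodMap Function.surjective_id
  have hker : c.comparison.ker = π.ker := by
    rw [c.ker_comparison hcomm, AddMonoidHom.ker_prodMap, QuotientAddGroup.ker_mk',
      AddMonoidHom.ker_id]
  exact (QuotientAddGroup.quotientKerEquivOfSurjective _
    (c.comparison_surjective hcomm hp hq)).symm.trans
    ((QuotientAddGroup.quotientAddEquivOfEq hker).trans
      (QuotientAddGroup.quotientKerEquivOfSurjective _ hπ))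

end CentralCover

/-! ### Central products -/

/-- In a central product `X = HK`, the projection onto `H / (H ∩ K)`. -/
theorem exists_projection {X : Type} [Group X] (H K A : Subgroup X) [K.Normal]
    [(A.subgroupOf H).Normal] (hprod : H ⊔ K = ⊤) (hA : A = H ⊓ K) :
    ∃ p : X →* H ⧸ A.subgroupOf H, (∀ g, p g = 1 ↔ g ∈ K) ∧
      ∀ h : H, p h = QuotientGroup.mk h := by
  subst hA
  let f : H ⧸ (H ⊓ K).subgroupOf H →* X ⧸ K :=
    QuotientGroup.map _ K H.subtype (fun x hx => hx.2)
  have hf : Function.Bijective f := by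
    constructor
    · rw [injective_iff_map_eq_one]
      intro x hx
      obtain ⟨x, rfl⟩ := QuotientGroup.mk_surjective x
      exact (QuotientGroup.eq_one_iff x).2 ⟨x.2, (QuotientGroup.eq_one_iff (x : X)).1 hx⟩
    · intro y
      obtain ⟨y, rfl⟩ := QuotientGroup.mk_surjective y
      obtain ⟨h, hh, k, hk, rfl⟩ := Subgroup.mem_sup_of_normal_right.1
        (hprod.symm ▸ Subgroup.mem_top y : y ∈ H ⊔ K)
      exact ⟨QuotientGroup.mk ⟨h, hh⟩, QuotientGroup.eq.2 (by simpa using hk)⟩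
  let F := MulEquiv.ofBijective f hf
  refine ⟨F.symm.toMonoidHom.comp (QuotientGroup.mk' K), fun g => ?_, fun h => ?_⟩
  · refine Iff.trans ?_ (QuotientGroup.eq_one_iff g)
    exact F.symm.map_eq_one_iff
  · exact F.symm_apply_apply (QuotientGroup.mk h)

/-- If `A = Z`, then `H²(G, D) ≅ ((H²(H/Z, D) ⊕ H²(K/Z, D))/N) ⊕ Hom(H/Z ⊗ K/Z, D)`
for a subgroup `N ≅ Hom(Z, D)`. -/
theorem h2_iso_of_A_eq_Z {G : Type} [Group G] (H K : Subgroup G) [H.Normal] [K.Normal]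
    (hprod : H ⊔ K = ⊤) (hcomm : ∀ h ∈ H, ∀ k ∈ K, Commute h k)
    (D : Type) [AddCommGroup D] [DivisibleBy D ℤ]
    [((⁅H, H⁆ ⊓ ⁅K, K⁆).subgroupOf H).Normal] [((⁅H, H⁆ ⊓ ⁅K, K⁆).subgroupOf K).Normal]
    (hAZ : H ⊓ K = ⁅H, H⁆ ⊓ ⁅K, K⁆) :
    ∃ N : AddSubgroup
        (H2 (↥H ⧸ (⁅H, H⁆ ⊓ ⁅K, K⁆).subgroupOf H) D ×
         H2 (↥K ⧸ (⁅H, H⁆ ⊓ ⁅K, K⁆).subgroupOf K) D),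
      Nonempty (↥N ≃+ (Additive ↥(⁅H, H⁆ ⊓ ⁅K, K⁆) →+ D)) ∧
      Nonempty (H2 G D ≃+
        (((H2 (↥H ⧸ (⁅H, H⁆ ⊓ ⁅K, K⁆).subgroupOf H) D ×
           H2 (↥K ⧸ (⁅H, H⁆ ⊓ ⁅K, K⁆).subgroupOf K) D) ⧸ N) ×
         (AbTensor (↥H ⧸ (⁅H, H⁆ ⊓ ⁅K, K⁆).subgroupOf H)
            (↥K ⧸ (⁅H, H⁆ ⊓ ⁅K, K⁆).subgroupOf K) →+ D))) := by
  obtain ⟨p, hp, hpH⟩ := exists_projection H K _ hprod hAZ.symm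
  obtain ⟨q, hq, hqK⟩ := exists_projection K H (⁅H, H⁆ ⊓ ⁅K, K⁆) (sup_comm H K ▸ hprod)
    (hAZ.symm.trans (inf_comm H K))
  have hpk : p.ker = K := Subgroup.ext hp
  have hqk : q.ker = H := Subgroup.ext hq
  let c : CentralCover G _ _ :=
    { p := p
      q := q
      S := fun x => (x.out : H)
      U := fun y => (y.out : K)
      p_S := fun x => (hpH _).trans x.out_eq'
      q_S := fun x => (hq _).2 x.out.2
      p_U := fun y => (hp _).2 y.out.2
      q_U := fun y => (hqK _).trans y.out_eq'
      C := ⁅H, H⁆ ⊓ ⁅K, K⁆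
      mem_C := fun g => by
        rw [hp, hq, and_comm, ← Subgroup.mem_inf, hAZ]
      central := fun z hz g => by
        rw [← hAZ] at hz
        obtain ⟨h, hh, k, hk, rfl⟩ := Subgroup.mem_sup_of_normal_right.1
          (hprod.symm ▸ Subgroup.mem_top g : g ∈ H ⊔ K)
        exact (hcomm h hh z hz.2).symm.mul_right (hcomm z hz.1 k hk) }
  refine c.exists_H2_equiv ?_ ?_ ?_
  · change ∀ h ∈ q.ker, ∀ k ∈ p.ker, Commute h k
    rwa [hpk, hqk]
  · change _ ≤ ⁅p.ker, p.ker⁆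
    rw [hpk]
    exact inf_le_right
  · change _ ≤ ⁅q.ker, q.ker⁆
    rw [hqk]
    exact inf_le_left

end SchurCP
end

section
/- If the inflation maps inf : H²(H/A, D) → H²(H/Z, D) and inf : H²(K/A, D) → H²(K/Z, D) are both surjective, then there is a subgroup N of H²(H/Z, D) ⊕ H²(K/Z, D) with N ≅ Hom(Z, D) such that H²(G, D) ≅ ((H²(H/Z, D) ⊕ H²(K/Z, D))/N) ⊕ Hom(H/A ⊗ K/A, D). -/
/-!
Setting (central products): `G` is a group with normal subgroups `H` and `K` such that
`G = HK` (i.e. `H ⊔ K = ⊤`) and `[H, K] = 1` (i.e. every element of `H` commutes with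
every element of `K`).  We set `A = H ⊓ K` and `Z = ⁅H,H⁆ ⊓ ⁅K,K⁆`; both are central
in `G`.  Coefficients are taken in a divisible abelian group `D`, regarded as a trivial
module.  Second cohomology `H2 X D` is realized concretely as (inhomogeneous)
2-cocycles modulo 2-coboundaries, and `Hom(X, D)` is realized as `Additive X →+ D`.
-/

open scoped TensorProduct

set_option maxHeartbeats 1000000
set_option synthInstance.maxHeartbeats 1000000
set_option synthInstance.maxSize 2000

namespace SchurCP

variable (G : Type) [Group G] (D : Type) [AddCommGroup D]

variable {G D}

section Cocycles

variable {P Q : Type} [Group P] [Group Q]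

theorem H2mk_surjective : Function.Surjective (H2mk : cocycles2 P D → H2 P D) :=
  QuotientAddGroup.mk_surjective

theorem H2mk_add (f g : cocycles2 P D) : H2mk (f + g) = H2mk f + H2mk g := rfl

theorem H2Map_mk (π : P →* Q) (f : cocycles2 Q D) :
    H2Map π (H2mk f) = H2mk (pullCocycle π f) := rfl

theorem H2mk_eq_zero_iff (f : cocycles2 P D) :
    H2mk f = 0 ↔ ∃ φ : P → D, ∀ x y, f.1 x y = φ x + φ y - φ (x * y) :=
  QuotientAddGroup.eq_zero_iff f

theorem H2mk_eq_iff (f g : cocycles2 P D) :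
    H2mk f = H2mk g ↔ ∃ φ : P → D, ∀ x y, f.1 x y = g.1 x y + (φ x + φ y - φ (x * y)) := by
  rw [← sub_eq_zero]
  refine (H2mk_eq_zero_iff (f - g)).trans (exists_congr fun φ => ?_)
  refine forall_congr' fun x => forall_congr' fun y => ?_
  exact sub_eq_iff_eq_add'

theorem cocycle_one_left (f : cocycles2 P D) (x : P) : f.1 1 x = f.1 1 1 := by
  have := f.2 1 1 x
  simp only [one_mul] at this
  exact (add_right_cancel this).symm

theorem cocycle_one_right (f : cocycles2 P D) (x : P) : f.1 x 1 = f.1 1 1 := by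
  have := f.2 x 1 1
  simp only [mul_one] at this
  exact add_right_cancel this

/-- The commutator pairing of a cocycle is additive in the second variable. -/
theorem cocycle_comm_mul_right (f : cocycles2 P D) {x y z : P} (hy : Commute x y)
    (hz : Commute x z) :
    f.1 x (y * z) - f.1 (y * z) x = (f.1 x y - f.1 y x) + (f.1 x z - f.1 z x) := by
  have h1 := f.2 x y z
  have h2 := f.2 y x z
  have h3 := f.2 y z x
  rw [hy.eq] at h1
  rw [hz.eq] at h2
  rw [← sub_eq_zero] at h1 h2 h3 ⊢
  rw [← neg_eq_zero]
  calc _ = (f.1 x y + f.1 (y * x) z - (f.1 y z + f.1 x (y * z)))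
        - (f.1 y x + f.1 (y * x) z - (f.1 x z + f.1 y (z * x)))
        + (f.1 y z + f.1 (y * z) x - (f.1 z x + f.1 y (z * x))) := by abel
    _ = 0 := by rw [h1, h2, h3]; simp

theorem cocycle_comm_mul_left (f : cocycles2 P D) {x y z : P} (hx : Commute x z)
    (hy : Commute y z) :
    f.1 (x * y) z - f.1 z (x * y) = (f.1 x z - f.1 z x) + (f.1 y z - f.1 z y) := by
  have := cocycle_comm_mul_right f hx.symm hy.symm
  rw [← neg_inj, neg_sub, this]
  abel

/-- A homomorphism to a divisible group from a subgroup meeting the commutator subgroup trivially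
extends to the whole group. -/
theorem exists_extend_of_divisible [DivisibleBy D ℤ] (M : Subgroup P) (χ : Additive M →+ D)
    (hM : ∀ m ∈ M, m ∈ commutator P → m = 1) :
    ∃ θ : P → D, (∀ x y, θ (x * y) = θ x + θ y) ∧ ∀ m : M, θ m = χ (Additive.ofMul m) := by
  let ι : M →* Abelianization P := Abelianization.of.comp M.subtype
  have hι : Function.Injective ι := by
    refine (injective_iff_map_eq_one ι).2 fun m hm => Subtype.ext (hM m m.2 ?_)
    rw [← Abelianization.ker_of]
    exact hm
  let _ : CommGroup M :=
    { (inferInstance : Group M) with mul_comm := fun a b => hι (by simp [mul_comm]) }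
  obtain ⟨θ, hθ⟩ := (Module.Baer.of_divisible D).extension_property_addMonoidHom
    (MonoidHom.toAdditive ι) hι χ
  refine ⟨fun x => θ (Additive.ofMul (Abelianization.of x)), fun x y => ?_, fun m => ?_⟩
  · simp only [map_mul, ofMul_mul, map_add]
  · exact DFunLike.congr_fun hθ (Additive.ofMul m)

/-- A symmetric cocycle on a commutative group with values in a divisible group is a
coboundary. -/
theorem exists_of_symmetric [DivisibleBy D ℤ] {M : Type} [CommGroup M] (f : cocycles2 M D)
    (hf : ∀ x y, f.1 x y = f.1 y x) :
    ∃ φ : M → D, ∀ x y, f.1 x y = φ x + φ y - φ (x * y) := by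
  let _ : Add (D × M) := ⟨fun a b => (a.1 + b.1 + f.1 a.2 b.2, a.2 * b.2)⟩
  let _ : Zero (D × M) := ⟨(-f.1 1 1, 1)⟩
  let _ : Neg (D × M) := ⟨fun a => (-a.1 - f.1 a.2⁻¹ a.2 - f.1 1 1, a.2⁻¹)⟩
  let _ : AddCommGroup (D × M) :=
    { nsmul := nsmulRec
      zsmul := zsmulRec
      add_assoc := fun a b c => by
        refine Prod.ext ?_ (mul_assoc _ _ _)
        change a.1 + b.1 + f.1 a.2 b.2 + c.1 + f.1 (a.2 * b.2) c.2 =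
          a.1 + (b.1 + c.1 + f.1 b.2 c.2) + f.1 a.2 (b.2 * c.2)
        calc _ = a.1 + b.1 + c.1 + (f.1 a.2 b.2 + f.1 (a.2 * b.2) c.2) := by abel
          _ = _ := by rw [f.2 a.2 b.2 c.2]; abel
      zero_add := fun a => by
        refine Prod.ext ?_ (one_mul _)
        change -f.1 1 1 + a.1 + f.1 1 a.2 = a.1
        rw [cocycle_one_left f a.2]; abel
      add_zero := fun a => by
        refine Prod.ext ?_ (mul_one _)
        change a.1 + -f.1 1 1 + f.1 a.2 1 = a.1
        rw [cocycle_one_right f a.2]; abel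
      neg_add_cancel := fun a => by
        refine Prod.ext ?_ (inv_mul_cancel _)
        change -a.1 - f.1 a.2⁻¹ a.2 - f.1 1 1 + a.1 + f.1 a.2⁻¹ a.2 = -f.1 1 1
        abel
      add_comm := fun a b => by
        refine Prod.ext ?_ (mul_comm _ _)
        change a.1 + b.1 + f.1 a.2 b.2 = b.1 + a.1 + f.1 b.2 a.2
        rw [hf a.2 b.2, add_comm a.1] }
  have hadd : ∀ a b : D × M, a + b = (a.1 + b.1 + f.1 a.2 b.2, a.2 * b.2) := fun _ _ => rfl
  let ι : D →+ D × M := AddMonoidHom.mk' (fun d => (d - f.1 1 1, 1)) fun d e => by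
    rw [hadd]
    refine Prod.ext ?_ (mul_one _).symm
    change d + e - f.1 1 1 = d - f.1 1 1 + (e - f.1 1 1) + f.1 1 1
    abel
  have hι : Function.Injective ι := fun d e h => sub_left_injective (congrArg Prod.fst h)
  obtain ⟨r, hr⟩ := (Module.Baer.of_divisible D).extension_property_addMonoidHom
    ι hι (AddMonoidHom.id D)
  refine ⟨fun m => r (0, m), fun x y => ?_⟩
  have h1 : ((0, x) + (0, y) : D × M) = ι (f.1 x y) + (0, x * y) := by
    rw [hadd, hadd]
    refine Prod.ext ?_ (one_mul _).symm
    change 0 + 0 + f.1 x y = f.1 x y - f.1 1 1 + 0 + f.1 1 (x * y)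
    rw [cocycle_one_left f (x * y)]; abel
  have h2 := congrArg r h1
  rw [map_add, map_add, show r (ι (f.1 x y)) = f.1 x y from DFunLike.congr_fun hr _] at h2
  rw [h2, add_sub_cancel_right]

/-- The special case of `exists_pullback_of_symmetric` for cocycles vanishing on the kernel. -/
theorem exists_pullback_of_vanishing (π : P →* Q) (hπ : Function.Surjective π)
    (hc : ∀ m ∈ π.ker, ∀ p, Commute m p) (f : cocycles2 P D)
    (hf : ∀ m ∈ π.ker, ∀ p, f.1 m p = f.1 p m) (h0 : ∀ m ∈ π.ker, ∀ n ∈ π.ker, f.1 m n = 0) :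
    ∃ g : cocycles2 Q D, H2mk (pullCocycle π g) = H2mk f := by
  obtain ⟨s, hs⟩ := hπ.hasRightInverse
  have hr : ∀ p, p * (s (π p))⁻¹ ∈ π.ker := fun p => by simp [MonoidHom.mem_ker, hs (π p)]
  let ψ : P → D := fun p => f.1 (p * (s (π p))⁻¹) (s (π p))
  have hψ : ∀ m ∈ π.ker, ∀ p, ψ (m * p) = ψ p + f.1 m p := by
    intro m hm p
    have h1 := f.2 m (p * (s (π p))⁻¹) (s (π p))
    rw [h0 m hm _ (hr p), zero_add, inv_mul_cancel_right, ← mul_assoc] at h1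
    have h2 : π (m * p) = π p := by rw [map_mul, (MonoidHom.mem_ker).1 hm, one_mul]
    simp only [ψ, h2, h1]
  let F : P → P → D := fun x y => f.1 x y + (ψ x + ψ y - ψ (x * y))
  have hF : ∀ x y z, F x y + F (x * y) z = F y z + F x (y * z) := by
    intro x y z
    simp only [F, mul_assoc]
    calc _ = (f.1 x y + f.1 (x * y) z) + ψ x + ψ y + ψ z - ψ (x * (y * z)) := by abel
      _ = _ := by rw [f.2 x y z]; abel
  have hF1 : ∀ m ∈ π.ker, ∀ x y, F (m * x) y = F x y := by
    intro m hm x y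
    simp only [F]
    rw [mul_assoc, hψ m hm, hψ m hm]
    have := f.2 m x y
    rw [← sub_eq_zero] at this ⊢
    rw [← this]; abel
  have hF2 : ∀ m ∈ π.ker, ∀ x y, F x (m * y) = F x y := by
    intro m hm x y
    simp only [F]
    rw [← mul_assoc, ← (hc m hm x).eq, mul_assoc, hψ m hm, hψ m hm]
    have h1 := f.2 m x y
    have h2 := f.2 x m y
    rw [← hf m hm x, ← (hc m hm x).eq] at h2
    rw [← sub_eq_zero] at h1 h2 ⊢
    rw [← sub_zero (0 : D)]
    nth_rewrite 1 [← h1]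
    rw [← h2]; abel
  have hFs : ∀ x y, F (s (π x)) (s (π y)) = F x y := by
    intro x y
    rw [← hF1 _ (hr x) (s (π x)), ← hF2 _ (hr y) _ (s (π y)), inv_mul_cancel_right,
      inv_mul_cancel_right]
  refine ⟨⟨fun x y => F (s x) (s y), fun x y z => ?_⟩, (H2mk_eq_iff _ _).2 ⟨ψ, hFs⟩⟩
  have h1 := hFs (s x * s y) (s z)
  have h2 := hFs (s x) (s y * s z)
  simp only [map_mul, hs _] at h1 h2
  simp only [h1, h2]
  exact hF _ _ _

/-- A cocycle on `P` with `f(m, p) = f(p, m)` for all `m` in the central kernel of `π : P → Q` is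
cohomologous to a cocycle pulled back from `Q`. -/
theorem exists_pullback_of_symmetric [DivisibleBy D ℤ] (π : P →* Q)
    (hπ : Function.Surjective π) (hc : ∀ m ∈ π.ker, ∀ p, Commute m p) (f : cocycles2 P D)
    (hf : ∀ m ∈ π.ker, ∀ p, f.1 m p = f.1 p m) :
    ∃ g : cocycles2 Q D, H2mk (pullCocycle π g) = H2mk f := by
  let _ : CommGroup π.ker :=
    { (inferInstance : Group π.ker) with
      mul_comm := fun a b => Subtype.ext (hc a a.2 b).eq }
  obtain ⟨φ, hφ⟩ := exists_of_symmetric (pullCocycle π.ker.subtype f) fun x y => hf x x.2 y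
  let ψ : P → D := Function.extend Subtype.val φ 0
  have hψ : ∀ m : π.ker, ψ m = φ m := fun m => Subtype.val_injective.extend_apply _ _ _
  let d : cocycles2 P D := ⟨fun x y => ψ x + ψ y - ψ (x * y), fun x y z => by
    simp only [mul_assoc]; abel⟩
  have hd : H2mk (f - d) = H2mk f := by
    refine (H2mk_eq_iff _ _).2 ⟨-ψ, fun x y => ?_⟩
    change f.1 x y - (ψ x + ψ y - ψ (x * y)) = f.1 x y + (-ψ x + -ψ y - -ψ (x * y))
    abel
  rw [← hd]
  refine exists_pullback_of_vanishing π hπ hc _ (fun m hm p => ?_) fun m hm n hn => ?_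
  · change f.1 m p - (ψ m + ψ p - ψ (m * p)) = f.1 p m - (ψ p + ψ m - ψ (p * m))
    rw [hf m hm, (hc m hm p).eq, add_comm (ψ m)]
  · have h1 := hφ ⟨m, hm⟩ ⟨n, hn⟩
    rw [← hψ, ← hψ, ← hψ] at h1
    exact sub_eq_zero.2 h1

/-- The difference between `p` and the chosen representative of its image, as an element of the
kernel. -/
noncomputable def sectionDefect (π : P →* Q) (s : Q → P) (hs : ∀ q, π (s q) = q) (p : P) : π.ker :=
  ⟨p * (s (π p))⁻¹, by simp [MonoidHom.mem_ker, hs]⟩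

theorem sectionDefect_mul_section (π : P →* Q) (s : Q → P) (hs : ∀ q, π (s q) = q) (p : P) :
    (sectionDefect π s hs p : P) * s (π p) = p :=
  inv_mul_cancel_right _ _

theorem sectionDefect_mul_left (π : P →* Q) (s : Q → P) (hs : ∀ q, π (s q) = q) (m : π.ker)
    (p : P) : sectionDefect π s hs (m * p) = m * sectionDefect π s hs p := by
  refine Subtype.ext ?_
  simp [sectionDefect, (MonoidHom.mem_ker).1 m.2, mul_assoc]

theorem sectionDefect_mul (π : P →* Q) (s : Q → P) (hs : ∀ q, π (s q) = q)
    (hc : ∀ m ∈ π.ker, ∀ p, Commute m p) (p r : P) :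
    sectionDefect π s hs (p * r) =
      sectionDefect π s hs p * (sectionDefect π s hs r *
        sectionDefect π s hs (s (π p) * s (π r))) := by
  rw [← sectionDefect_mul_left, ← sectionDefect_mul_left]
  congr 1
  nth_rewrite 1 [← sectionDefect_mul_section π s hs p, ← sectionDefect_mul_section π s hs r]
  rw [mul_assoc, mul_left_cancel_iff, ← mul_assoc, ← mul_assoc,
    (hc _ (sectionDefect π s hs r).2 _).eq]

theorem sectionDefect_section (π : P →* Q) (s : Q → P) (hs : ∀ q, π (s q) = q) (q : Q) :
    sectionDefect π s hs (s q) = 1 :=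
  Subtype.ext (by simp [sectionDefect, hs])

/-- The transgression cocycle of a character of the central kernel of `π : P → Q`. -/
noncomputable def transCocycle (π : P →* Q) (s : Q → P) (hs : ∀ q, π (s q) = q)
    (hc : ∀ m ∈ π.ker, ∀ p, Commute m p) : (Additive π.ker →+ D) →+ cocycles2 Q D where
  toFun χ := ⟨fun x y => χ (Additive.ofMul (sectionDefect π s hs (s x * s y))), by
    intro x y z
    have h1 := sectionDefect_mul π s hs hc (s x * s y) (s z)
    have h2 := sectionDefect_mul π s hs hc (s x) (s y * s z)
    rw [mul_assoc, h2] at h1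
    have h3 := congrArg (fun m => χ (Additive.ofMul m)) h1
    simp only [map_mul, hs, ofMul_mul, map_add, sectionDefect_section, ofMul_one,
      zero_add] at h3
    exact h3.symm⟩
  map_zero' := rfl
  map_add' _ _ := rfl

/-- For a central kernel contained in the commutator subgroup, the kernel of inflation is
isomorphic, by transgression, to the group of characters of the kernel. -/
theorem nonempty_ker_H2Map_equiv (π : P →* Q) (hπ : Function.Surjective π)
    (hc : ∀ m ∈ π.ker, ∀ p, Commute m p) (hcomm : π.ker ≤ commutator P) :
    Nonempty ((H2Map π : H2 Q D →+ H2 P D).ker ≃+ (Additive π.ker →+ D)) := by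
  obtain ⟨s, hs⟩ := hπ.hasRightInverse
  let tra : (Additive π.ker →+ D) →+ H2 Q D :=
    AddMonoidHom.mk' (fun χ => H2mk (transCocycle π s hs hc χ)) fun χ χ' => by
      rw [map_add, H2mk_add]
  have key : ∀ (χ : Additive π.ker →+ D) (x y : P),
      χ (Additive.ofMul (sectionDefect π s hs (x * y))) =
        χ (Additive.ofMul (sectionDefect π s hs x)) +
        (χ (Additive.ofMul (sectionDefect π s hs y)) +
          (transCocycle π s hs hc χ).1 (π x) (π y)) := fun χ x y => by
    rw [sectionDefect_mul π s hs hc, ofMul_mul, ofMul_mul, map_add, map_add]; rfl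
  have hinj : Function.Injective tra := by
    refine (injective_iff_map_eq_zero tra).2 fun χ hχ => ?_
    obtain ⟨ψ, hψ⟩ := (H2mk_eq_zero_iff _).1 hχ
    let θ : P →* Multiplicative D := MonoidHom.mk' (fun p => Multiplicative.ofAdd
      (χ (Additive.ofMul (sectionDefect π s hs p)) + ψ (π p))) fun x y => by
        rw [← ofAdd_add, key, hψ, map_mul]
        congr 1; abel
    have hθ : ∀ m : π.ker, θ m = 1 := fun m => Abelianization.commutator_subset_ker θ (hcomm m.2)
    refine AddMonoidHom.ext fun m => ?_
    have h1 : χ (Additive.ofMul (sectionDefect π s hs (m.toMul : P))) + ψ (π m.toMul) = 0 :=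
      hθ m.toMul
    have h2 : χ (Additive.ofMul (sectionDefect π s hs 1)) + ψ (π 1) = 0 := map_one θ
    have h3 := sectionDefect_mul_left π s hs m.toMul 1
    rw [mul_one] at h3
    rw [h3, ofMul_mul, map_add, (MonoidHom.mem_ker).1 m.toMul.2, add_assoc, ← map_one π, h2,
      add_zero] at h1
    exact h1
  have hrange : tra.range = (H2Map π : H2 Q D →+ H2 P D).ker := by
    ext c
    constructor
    · rintro ⟨χ, rfl⟩
      refine (H2mk_eq_zero_iff _).2 ⟨fun p => -χ (Additive.ofMul (sectionDefect π s hs p)),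
        fun x y => ?_⟩
      change (transCocycle π s hs hc χ).1 (π x) (π y) = _
      simp only [key]; abel
    · obtain ⟨f, rfl⟩ := H2mk_surjective c
      intro hf
      obtain ⟨φ, hφ⟩ := (H2mk_eq_zero_iff _).1 hf
      have hφ' : ∀ x y, f.1 (π x) (π y) = φ x + φ y - φ (x * y) := hφ
      have h1 : ∀ m ∈ π.ker, ∀ p, φ (m * p) = φ m - φ 1 + φ p := by
        intro m hm p
        have h2 := hφ' m p
        have h3 := hφ' 1 1
        rw [(MonoidHom.mem_ker).1 hm, cocycle_one_left] at h2
        rw [map_one, h2] at h3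
        simp only [mul_one, add_sub_cancel_right] at h3
        rw [← h3]; abel
      let χ : Additive π.ker →+ D := AddMonoidHom.mk' (fun m => φ (m.toMul : P) - φ 1)
        fun m n => by
          rw [toMul_add, Subgroup.coe_mul, h1 _ m.toMul.2]; abel
      refine ⟨-χ, (H2mk_eq_iff _ _).2 ⟨-fun q => φ (s q), fun x y => ?_⟩⟩
      have h2 := hφ' (s x) (s y)
      have h3 := sectionDefect_mul_section π s hs (s x * s y)
      rw [← h3, h1 _ (sectionDefect π s hs _).2, map_mul, hs, hs] at h2
      change -(φ (sectionDefect π s hs (s x * s y)) - φ 1) =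
        f.1 x y + (-φ (s x) + -φ (s y) - -φ (s (x * y)))
      rw [h2]; abel
  exact ⟨((AddMonoidHom.ofInjective hinj).trans (AddEquiv.addSubgroupCongr hrange)).symm⟩

end Cocycles

section Descent

variable {P Q : Type} [Group P] [Group Q]

/-- Inflation along a surjection with central kernel meeting the commutator subgroup trivially is
injective for divisible coefficients. -/
theorem H2Map_injective_of_ker_inf_commutator [DivisibleBy D ℤ] (π : P →* Q)
    (hπ : Function.Surjective π) (hM : ∀ m ∈ π.ker, m ∈ commutator P → m = 1) :
    Function.Injective (H2Map π : H2 Q D →+ H2 P D) := by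
  refine (injective_iff_map_eq_zero _).2 fun c hc => ?_
  obtain ⟨f, rfl⟩ := H2mk_surjective c
  obtain ⟨φ, hφ⟩ := (H2mk_eq_zero_iff _).1 hc
  have hφ' : ∀ x y, f.1 (π x) (π y) = φ x + φ y - φ (x * y) := hφ
  have h1 : ∀ m ∈ π.ker, ∀ p, φ (m * p) = φ m - φ 1 + φ p := by
    intro m hm p
    have h2 := hφ' m p
    have h3 := hφ' 1 1
    rw [(MonoidHom.mem_ker).1 hm, cocycle_one_left] at h2
    rw [map_one, h2] at h3
    simp only [mul_one, add_sub_cancel_right] at h3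
    rw [← h3]; abel
  let χ : Additive π.ker →+ D := AddMonoidHom.mk' (fun m => φ (m.toMul : P) - φ 1)
    fun m n => by
      rw [toMul_add, Subgroup.coe_mul, h1 _ m.toMul.2]; abel
  obtain ⟨θ, hθ, hθχ⟩ := exists_extend_of_divisible π.ker χ hM
  obtain ⟨s, hs⟩ := hπ.hasRightInverse
  have h2 : ∀ p, φ p - θ p = φ (s (π p)) - θ (s (π p)) := by
    intro p
    have hr : p * (s (π p))⁻¹ ∈ π.ker := by simp [MonoidHom.mem_ker, hs (π p)]
    have h3 := h1 _ hr (s (π p))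
    have h4 := hθ (p * (s (π p))⁻¹) (s (π p))
    have h5 : θ (p * (s (π p))⁻¹) = φ (p * (s (π p))⁻¹) - φ 1 := hθχ ⟨_, hr⟩
    rw [inv_mul_cancel_right] at h3 h4
    rw [h3, h4, h5]; abel
  refine (H2mk_eq_zero_iff _).2 ⟨fun q => φ (s q) - θ (s q), fun x y => ?_⟩
  have h3 := hφ' (s x) (s y)
  have h4 := h2 (s x * s y)
  rw [map_mul, hs, hs] at h4
  rw [hs, hs] at h3
  simp only [← h4, hθ, h3]
  abel

/-- A product cocycle assembled from cocycles on the factors and a bilinear pairing. -/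
def prodCocycle {X Y : Type} [Group X] [Group Y] (f : cocycles2 X D) (g : cocycles2 Y D)
    (p : X → Y → D) (hl : ∀ x x' y, p (x * x') y = p x y + p x' y)
    (hr : ∀ x y y', p x (y * y') = p x y + p x y') : cocycles2 (X × Y) D :=
  ⟨fun a b => f.1 a.1 b.1 + g.1 a.2 b.2 + p a.1 b.2, by
    intro a b c
    simp only [Prod.fst_mul, Prod.snd_mul, hl, hr]
    calc _ = (f.1 a.1 b.1 + f.1 (a.1 * b.1) c.1) + (g.1 a.2 b.2 + g.1 (a.2 * b.2) c.2) +
          (p a.1 b.2 + p a.1 c.2 + p b.1 c.2) := by abel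
      _ = _ := by rw [f.2 a.1, g.2 a.2]; abel⟩

/-- A cocycle on a product which is a coboundary on both factors and whose commutator pairing
vanishes is a coboundary. -/
theorem H2mk_prod_eq_zero {X Y : Type} [Group X] [Group Y] (f : cocycles2 (X × Y) D)
    (hX : H2Map (MonoidHom.inl X Y) (H2mk f) = 0) (hY : H2Map (MonoidHom.inr X Y) (H2mk f) = 0)
    (hXY : ∀ x y, f.1 (x, 1) (1, y) = f.1 (1, y) (x, 1)) : H2mk f = 0 := by
  obtain ⟨α, hα⟩ := (H2mk_eq_zero_iff _).1 hX
  obtain ⟨γ, hγ⟩ := (H2mk_eq_zero_iff _).1 hY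
  have hα' : ∀ x x', f.1 (x, 1) (x', 1) = α x + α x' - α (x * x') := hα
  have hγ' : ∀ y y', f.1 (1, y) (1, y') = γ y + γ y' - γ (y * y') := hγ
  refine (H2mk_eq_zero_iff _).2 ⟨fun a => α a.1 + γ a.2 - f.1 (a.1, 1) (1, a.2), ?_⟩
  rintro ⟨x, y⟩ ⟨x', y'⟩
  have h1 := f.2 (x, 1) (1, y) (x', y')
  have h2 := f.2 (1, y) (x', 1) (1, y')
  have h3 := f.2 (x', 1) (1, y) (1, y')
  have h4 := f.2 (x, 1) (x', 1) (1, y * y')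
  simp only [Prod.mk_mul_mk, one_mul, mul_one] at h1 h2 h3 h4 ⊢
  rw [hXY x' y] at h3
  rw [hα'] at h4
  rw [hγ'] at h3
  rw [← sub_eq_zero] at h1 h2 h3 h4 ⊢
  have h5 := congrArg₂ (· - ·) (congrArg₂ (· + ·) (congrArg₂ (· - ·) h1 h2) h3) h4
  simp only [sub_zero, add_zero] at h5
  rw [← h5]; abel

end Descent

section Pairing

variable {X Y X' Y' : Type} [Group X] [Group Y] [Group X'] [Group Y']

/-- The bilinear pairings `X × Y → D` vanishing on the kernels of `u : X → X'` and
`v : Y → Y'`. -/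
def pairings (u : X →* X') (v : Y →* Y') (D : Type) [AddCommGroup D] :
    AddSubgroup (X → Y → D) where
  carrier := {p | (∀ x x' y, p (x * x') y = p x y + p x' y) ∧
    (∀ x y y', p x (y * y') = p x y + p x y') ∧ (∀ x y, u x = 1 → p x y = 0) ∧
    ∀ x y, v y = 1 → p x y = 0}
  zero_mem' := by simp
  add_mem' := by
    rintro p q ⟨hp1, hp2, hp3, hp4⟩ ⟨hq1, hq2, hq3, hq4⟩
    refine ⟨fun x x' y => ?_, fun x y y' => ?_, fun x y h => ?_, fun x y h => ?_⟩
    · simp only [Pi.add_apply, hp1, hq1]; abel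
    · simp only [Pi.add_apply, hp2, hq2]; abel
    · simp [hp3 x y h, hq3 x y h]
    · simp [hp4 x y h, hq4 x y h]
  neg_mem' := by
    rintro p ⟨hp1, hp2, hp3, hp4⟩
    refine ⟨fun x x' y => ?_, fun x y y' => ?_, fun x y h => ?_, fun x y h => ?_⟩
    · simp only [Pi.neg_apply, hp1]; abel
    · simp only [Pi.neg_apply, hp2]; abel
    · simp [hp3 x y h]
    · simp [hp4 x y h]

/-- The pairing on `X × Y` associated with a homomorphism on the abelian tensor product of the
quotients. -/
noncomputable def tensorPairing (u : X →* X') (v : Y →* Y') :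
    (AbTensor X' Y' →+ D) →+ pairings u v D where
  toFun b := ⟨fun x y => b (tmulAb (u x) (v y)), by
    refine ⟨fun x x' y => ?_, fun x y y' => ?_, fun x y h => ?_, fun x y h => ?_⟩
    · simp only [tmulAb, map_mul, ofMul_mul, TensorProduct.add_tmul, map_add]
    · simp only [tmulAb, map_mul, ofMul_mul, TensorProduct.tmul_add, map_add]
    · simp [tmulAb, h]
    · simp [tmulAb, h]⟩
  map_zero' := rfl
  map_add' _ _ := rfl

theorem exists_lift_of_surjective {C : Type} [AddCommGroup C] (u : X →* X')
    (hu : Function.Surjective u) (φ : X → C) (hφ : ∀ x x', φ (x * x') = φ x + φ x')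
    (h1 : ∀ x, u x = 1 → φ x = 0) :
    ∃ ψ : Additive (Abelianization X') →+ C,
      ∀ x, ψ (Additive.ofMul (Abelianization.of (u x))) = φ x := by
  let φ' : X →* Multiplicative C :=
    MonoidHom.mk' (fun x => Multiplicative.ofAdd (φ x)) fun x x' => by rw [hφ, ofAdd_add]
  let φ'' : X' →* Multiplicative C := u.liftOfSurjective hu ⟨φ', fun x hx => h1 x hx⟩
  refine ⟨MonoidHom.toAdditiveLeft (Abelianization.lift φ''), fun x => ?_⟩
  change Multiplicative.toAdd (Abelianization.lift φ'' (Abelianization.of (u x))) = _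
  rw [Abelianization.lift_apply_of]
  exact congrArg Multiplicative.toAdd
    (u.liftOfRightInverse_comp_apply _ (Function.rightInverse_surjInv hu) ⟨φ', h1⟩ x)

theorem exists_eq_ofMul_of (u : X →* X') (hu : Function.Surjective u)
    (s : Additive (Abelianization X')) : ∃ x, s = Additive.ofMul (Abelianization.of (u x)) := by
  obtain ⟨x', hx'⟩ := QuotientGroup.mk_surjective s.toMul
  obtain ⟨x, rfl⟩ := hu x'
  exact ⟨x, hx'.symm⟩

theorem tensorPairing_bijective (u : X →* X') (v : Y →* Y') (hu : Function.Surjective u)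
    (hv : Function.Surjective v) :
    Function.Bijective (tensorPairing u v : (AbTensor X' Y' →+ D) →+ pairings u v D) := by
  constructor
  · refine (injective_iff_map_eq_zero _).2 fun b hb => ?_
    have hb' : ∀ x y, b (tmulAb (u x) (v y)) = 0 := fun x y =>
      congrFun (congrFun (congrArg Subtype.val hb) x) y
    refine AddMonoidHom.ext fun t => ?_
    induction t using TensorProduct.induction_on with
    | zero => simp
    | add s t hs ht => rw [map_add, map_add, hs, ht]
    | tmul s t =>
      obtain ⟨x, rfl⟩ := exists_eq_ofMul_of u hu s
      obtain ⟨y, rfl⟩ := exists_eq_ofMul_of v hv t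
      exact hb' x y
  · rintro ⟨p, hp1, hp2, hp3, hp4⟩
    choose ψ hψ using fun x => exists_lift_of_surjective v hv (p x) (hp2 x) (hp4 x)
    have hext : ∀ ρ ρ' : Additive (Abelianization Y') →+ D,
        (∀ y, ρ (Additive.ofMul (Abelianization.of (v y))) =
          ρ' (Additive.ofMul (Abelianization.of (v y)))) → ρ = ρ' := by
      intro ρ ρ' h
      refine AddMonoidHom.ext fun t => ?_
      obtain ⟨y, rfl⟩ := exists_eq_ofMul_of v hv t
      exact h y
    obtain ⟨b, hb⟩ := exists_lift_of_surjective u hu ψ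
      (fun x x' => hext _ _ fun y => by simp [hψ, hp1])
      (fun x hx => hext _ _ fun y => by simp [hψ, hp3 x y hx])
    refine ⟨TensorProduct.liftAddHom b fun r s t => by simp, Subtype.ext ?_⟩
    funext x y
    change TensorProduct.liftAddHom b _ (tmulAb (u x) (v y)) = p x y
    rw [TensorProduct.liftAddHom_tmul, hb, hψ]

end Pairing

section CentralProduct

variable {P Q X Y X' Y' : Type} [Group P] [Group Q] [Group X] [Group Y] [Group X'] [Group Y']

theorem H2Map_H2Map (π : X →* P) (ρ : P →* Q) (c : H2 Q D) :
    H2Map π (H2Map ρ c) = H2Map (ρ.comp π) c := by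
  obtain ⟨f, rfl⟩ := H2mk_surjective c
  rfl

/-- The commutator pairing of a cohomology class restricted to two commuting groups. -/
def commPairing (i : X →* Q) (j : Y →* Q) (hij : ∀ x y, Commute (i x) (j y)) :
    H2 Q D →+ (X → Y → D) :=
  QuotientAddGroup.lift _
    { toFun := fun f : cocycles2 Q D => fun x y => f.1 (i x) (j y) - f.1 (j y) (i x)
      map_zero' := by funext x y; exact sub_self 0
      map_add' := fun f g => by funext x y; exact add_sub_add_comm _ _ _ _ } (by
    rintro f ⟨φ, hφ⟩
    funext x y
    have h1 := hφ (i x) (j y)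
    have h2 := hφ (j y) (i x)
    rw [← (hij x y).eq, add_comm] at h2
    exact sub_eq_zero.2 (h1.trans h2.symm))

theorem commPairing_mk (i : X →* Q) (j : Y →* Q) (hij : ∀ x y, Commute (i x) (j y))
    (f : cocycles2 Q D) (x : X) (y : Y) :
    commPairing i j hij (H2mk f) x y = f.1 (i x) (j y) - f.1 (j y) (i x) := rfl

theorem cocycle_symm_of_inflation_surjective (u : X →* X')
    (hu : Function.Surjective (H2Map u : H2 X' D →+ H2 X D)) (f : cocycles2 X D) {a x : X}
    (ha : u a = 1) (hax : Commute a x) : f.1 a x = f.1 x a := by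
  obtain ⟨c, hc⟩ := hu (H2mk f)
  obtain ⟨g, rfl⟩ := H2mk_surjective c
  obtain ⟨φ, hφ⟩ := (H2mk_eq_iff _ _).1 hc.symm
  have h1 : f.1 a x = g.1 (u a) (u x) + (φ a + φ x - φ (a * x)) := hφ a x
  have h2 : f.1 x a = g.1 (u x) (u a) + (φ x + φ a - φ (x * a)) := hφ x a
  rw [h1, h2, ha, cocycle_one_left g (u x), cocycle_one_right g (u x), hax.eq, add_comm (φ a)]

theorem commPairing_mem_pairings (i : X →* Q) (j : Y →* Q) (hij : ∀ x y, Commute (i x) (j y))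
    (hi : Function.Injective i) (hj : Function.Injective j) (u : X →* X') (v : Y →* Y')
    (hu : ∀ x, u x = 1 ↔ i x ∈ j.range) (hv : ∀ y, v y = 1 ↔ j y ∈ i.range)
    (hinfu : Function.Surjective (H2Map u : H2 X' D →+ H2 X D))
    (hinfv : Function.Surjective (H2Map v : H2 Y' D →+ H2 Y D)) (c : H2 Q D) :
    commPairing i j hij c ∈ pairings u v D := by
  obtain ⟨f, rfl⟩ := H2mk_surjective c
  refine ⟨fun x x' y => ?_, fun x y y' => ?_, fun x y h => ?_, fun x y h => ?_⟩
  · simp only [commPairing_mk, map_mul]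
    exact cocycle_comm_mul_left f (hij x y) (hij x' y)
  · simp only [commPairing_mk, map_mul]
    exact cocycle_comm_mul_right f (hij x y) (hij x y')
  · obtain ⟨y₀, hy₀⟩ := (hu x).1 h
    have hc : Commute y₀ y := hj (by rw [map_mul, map_mul, hy₀, (hij x y).eq])
    rw [commPairing_mk, ← hy₀]
    exact sub_eq_zero.2 (cocycle_symm_of_inflation_surjective v hinfv (pullCocycle j f)
      ((hv y₀).2 ⟨x, hy₀.symm⟩) hc)
  · obtain ⟨x₀, hx₀⟩ := (hv y).1 h
    have hc : Commute x₀ x := hi (by rw [map_mul, map_mul, hx₀, (hij x y).eq])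
    rw [commPairing_mk, ← hx₀]
    exact sub_eq_zero.2 (cocycle_symm_of_inflation_surjective u hinfu (pullCocycle i f)
      ((hu x₀).2 ⟨y, hx₀.symm⟩) hc).symm

/-- A cohomology class of a central product is determined by its restrictions to the factors and
its commutator pairing, provided that the commutator subgroups of the factors meet trivially. -/
theorem eq_zero_of_restrictions_eq_zero [DivisibleBy D ℤ] (i : X →* Q) (j : Y →* Q)
    (hij : ∀ x y, Commute (i x) (j y)) (hj : Function.Injective j)
    (hπ : Function.Surjective (i.noncommCoprod j hij))
    (hcomm : ∀ x ∈ commutator X, ∀ y ∈ commutator Y, i x * j y = 1 → x = 1) (c : H2 Q D)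
    (hX : H2Map i c = 0) (hY : H2Map j c = 0) (hXY : commPairing i j hij c = 0) : c = 0 := by
  refine (injective_iff_map_eq_zero _).1
    (H2Map_injective_of_ker_inf_commutator (i.noncommCoprod j hij) hπ ?_) c ?_
  · rintro ⟨x, y⟩ hm hm'
    have hx : x ∈ commutator X := by
      have := Subgroup.mem_map_of_mem (MonoidHom.fst X Y) hm'
      rw [commutator_def, Subgroup.map_commutator] at this
      exact Subgroup.commutator_mono le_top le_top this
    have hy : y ∈ commutator Y := by
      have := Subgroup.mem_map_of_mem (MonoidHom.snd X Y) hm'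
      rw [commutator_def, Subgroup.map_commutator] at this
      exact Subgroup.commutator_mono le_top le_top this
    have hxy : i x * j y = 1 := hm
    obtain rfl := hcomm x hx y hy hxy
    rw [map_one, one_mul, ← map_one j] at hxy
    exact Prod.ext rfl (hj hxy)
  · obtain ⟨f, rfl⟩ := H2mk_surjective c
    rw [H2Map_mk]
    refine H2mk_prod_eq_zero _ ?_ ?_ fun x y => ?_
    · rwa [← H2Map_mk, H2Map_H2Map, MonoidHom.noncommCoprod_comp_inl]
    · rwa [← H2Map_mk, H2Map_H2Map, MonoidHom.noncommCoprod_comp_inr]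
    · have h : f.1 (i x) (j y) - f.1 (j y) (i x) = 0 := congrFun (congrFun hXY x) y
      change f.1 (i x * j 1) (i 1 * j y) = f.1 (i 1 * j y) (i x * j 1)
      simpa only [map_one, one_mul, mul_one] using sub_eq_zero.1 h

/-- Cohomology classes on the factors of a central product together with a pairing come from a
cohomology class of the central product. -/
theorem exists_of_restrictions [DivisibleBy D ℤ] (i : X →* Q) (j : Y →* Q)
    (hij : ∀ x y, Commute (i x) (j y)) (hi : Function.Injective i) (hj : Function.Injective j)
    (hπ : Function.Surjective (i.noncommCoprod j hij)) (u : X →* X') (v : Y →* Y')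
    (hu : ∀ x, u x = 1 ↔ i x ∈ j.range) (hv : ∀ y, v y = 1 ↔ j y ∈ i.range)
    (hinfu : Function.Surjective (H2Map u : H2 X' D →+ H2 X D))
    (hinfv : Function.Surjective (H2Map v : H2 Y' D →+ H2 Y D))
    (a : H2 X D) (b : H2 Y D) (p : X → Y → D) (hp : p ∈ pairings u v D) :
    ∃ c : H2 Q D, H2Map i c = a ∧ H2Map j c = b ∧ commPairing i j hij c = p := by
  obtain ⟨f, rfl⟩ := H2mk_surjective a
  obtain ⟨g, rfl⟩ := H2mk_surjective b
  obtain ⟨hp1, hp2, hp3, hp4⟩ := hp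
  have hker : ∀ m ∈ (i.noncommCoprod j hij).ker, (u m.1 = 1 ∧ v m.2 = 1) ∧
      (∀ x, Commute m.1 x) ∧ ∀ y, Commute m.2 y := by
    rintro ⟨x, y⟩ hm
    have hxy : i x * j y = 1 := hm
    have h1 : i x = j y⁻¹ := by rw [map_inv]; exact eq_inv_of_mul_eq_one_left hxy
    have h2 : j y = i x⁻¹ := by rw [map_inv]; exact eq_inv_of_mul_eq_one_right hxy
    refine ⟨⟨(hu x).2 ⟨_, h1.symm⟩, (hv y).2 ⟨_, h2.symm⟩⟩, fun x' => hi ?_, fun y' => hj ?_⟩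
    · rw [map_mul, map_mul, h1, (hij x' _).eq]
    · rw [map_mul, map_mul, h2, (hij _ y').eq]
  obtain ⟨q, hq⟩ := exists_pullback_of_symmetric (i.noncommCoprod j hij) hπ
    (fun m hm a => Prod.ext ((hker m hm).2.1 a.1).eq ((hker m hm).2.2 a.2).eq)
    (prodCocycle f g p hp1 hp2) (fun m hm a => by
      obtain ⟨⟨h1, h2⟩, h3, h4⟩ := hker m hm
      change f.1 m.1 a.1 + g.1 m.2 a.2 + p m.1 a.2 = f.1 a.1 m.1 + g.1 a.2 m.2 + p a.1 m.2
      rw [cocycle_symm_of_inflation_surjective u hinfu f h1 (h3 _),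
        cocycle_symm_of_inflation_surjective v hinfv g h2 (h4 _), hp3 _ _ h1, hp4 _ _ h2])
  rw [← H2Map_mk] at hq
  refine ⟨H2mk q, ?_, ?_, ?_⟩
  · rw [← MonoidHom.noncommCoprod_comp_inl i j hij, ← H2Map_H2Map, hq, H2Map_mk]
    refine (H2mk_eq_iff _ _).2 ⟨fun _ => g.1 1 1, fun x x' => ?_⟩
    change f.1 x x' + g.1 1 1 + p x 1 = f.1 x x' + (g.1 1 1 + g.1 1 1 - g.1 1 1)
    rw [hp4 _ _ (map_one v)]; abel
  · rw [← MonoidHom.noncommCoprod_comp_inr i j hij, ← H2Map_H2Map, hq, H2Map_mk]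
    refine (H2mk_eq_iff _ _).2 ⟨fun _ => f.1 1 1, fun y y' => ?_⟩
    change f.1 1 1 + g.1 y y' + p 1 y' = g.1 y y' + (f.1 1 1 + f.1 1 1 - f.1 1 1)
    rw [hp3 _ _ (map_one u)]; abel
  · funext x y
    have h1 : commPairing (MonoidHom.inl X Y) (MonoidHom.inr X Y) MonoidHom.commute_inl_inr
        (H2Map (i.noncommCoprod j hij) (H2mk q)) x y = commPairing i j hij (H2mk q) x y := by
      change q.1 (i x * j 1) (i 1 * j y) - q.1 (i 1 * j y) (i x * j 1) = _
      simp only [map_one, one_mul, mul_one]; rfl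
    rw [← h1, hq]
    change f.1 x 1 + g.1 1 y + p x y - (f.1 1 x + g.1 y 1 + p 1 1) = p x y
    rw [cocycle_one_left f x, cocycle_one_left g y, cocycle_one_right f x,
      cocycle_one_right g y, hp3 _ _ (map_one u)]
    abel

end CentralProduct

theorem exists_quotient_prod_equiv {V W X B : Type} [AddCommGroup V] [AddCommGroup W]
    [AddCommGroup X] [AddCommGroup B] (inf : W →+ V) (hinf : Function.Surjective inf)
    (ρ : W →+ X) (β : W →+ B) (hbij : Function.Bijective (ρ.prod β))
    (hker : ∀ w, inf w = 0 → β w = 0) :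
    ∃ N : AddSubgroup X, Nonempty (N ≃+ inf.ker) ∧ Nonempty (V ≃+ (X ⧸ N) × B) := by
  have hinj : ∀ w, ρ w = 0 → β w = 0 → w = 0 := fun w h1 h2 =>
    (injective_iff_map_eq_zero _).1 hbij.1 w (Prod.ext h1 h2)
  let ρ' : inf.ker →+ X := ρ.comp inf.ker.subtype
  have hρ' : Function.Injective ρ' := (injective_iff_map_eq_zero _).2 fun w hw =>
    Subtype.ext (hinj w hw (hker w w.2))
  refine ⟨ρ'.range, ⟨(AddMonoidHom.ofInjective hρ').symm⟩, ?_⟩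
  let Ψ : W →+ (X ⧸ ρ'.range) × B := ((QuotientAddGroup.mk' ρ'.range).comp ρ).prod β
  have hΨ : Function.Surjective Ψ := by
    rintro ⟨x, b⟩
    obtain ⟨x, rfl⟩ := QuotientAddGroup.mk_surjective x
    obtain ⟨w, hw⟩ := hbij.2 (x, b)
    have h1 : ρ w = x := congrArg Prod.fst hw
    have h2 : β w = b := congrArg Prod.snd hw
    exact ⟨w, Prod.ext (congrArg (QuotientAddGroup.mk' ρ'.range) h1) h2⟩
  have hker' : inf.ker = Ψ.ker := by
    ext w
    constructor
    · intro hw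
      exact Prod.ext ((QuotientAddGroup.eq_zero_iff _).2 ⟨⟨w, hw⟩, rfl⟩) (hker w hw)
    · intro hw
      obtain ⟨y, hy⟩ := (QuotientAddGroup.eq_zero_iff _).1 (congrArg Prod.fst hw)
      have hy' : ρ y = ρ w := hy
      have hβ : β w = 0 := congrArg Prod.snd hw
      have : w - y = 0 := hinj _ (by rw [map_sub, hy', sub_self])
        (by rw [map_sub, hβ, hker y y.2, sub_self])
      rw [sub_eq_zero.1 this]
      exact y.2
  exact ⟨(QuotientAddGroup.quotientKerEquivOfSurjective inf hinf).symm.trans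
    ((QuotientAddGroup.quotientAddEquivOfEq hker').trans
      (QuotientAddGroup.quotientKerEquivOfSurjective Ψ hΨ))⟩

section Subgroups

variable {G : Type} [Group G] (H K : Subgroup G)

theorem exists_mul_eq_of_sup_eq_top [K.Normal] (hprod : H ⊔ K = ⊤) (g : G) :
    ∃ h ∈ H, ∃ k ∈ K, h * k = g :=
  Subgroup.mem_sup_of_normal_right.1 (hprod ▸ Subgroup.mem_top g)

theorem commute_of_mem_inf (hprod : H ⊔ K = ⊤) [K.Normal]
    (hcomm : ∀ h ∈ H, ∀ k ∈ K, Commute h k) {a : G} (ha : a ∈ H ⊓ K) (g : G) : Commute a g := by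
  obtain ⟨h, hh, k, hk, rfl⟩ := exists_mul_eq_of_sup_eq_top H K hprod g
  exact (hcomm h hh a ha.2).symm.mul_right (hcomm a ha.1 k hk)

theorem cocycle_symm_of_mem_commutator_inf (hprod : H ⊔ K = ⊤) [K.Normal]
    (hcomm : ∀ h ∈ H, ∀ k ∈ K, Commute h k) (f : cocycles2 G D) {z : G}
    (hz : z ∈ ⁅H, H⁆ ⊓ ⁅K, K⁆) (g : G) : f.1 z g = f.1 g z := by
  have key : ∀ (L : Subgroup G) (x : G), (∀ y ∈ L, Commute x y) → z ∈ ⁅L, L⁆ →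
      f.1 x z - f.1 z x = 0 := by
    intro L x hx hzL
    let θ : L →* Multiplicative D := MonoidHom.mk'
      (fun y => Multiplicative.ofAdd (f.1 x y - f.1 y x)) fun y y' => by
        rw [← ofAdd_add, ← cocycle_comm_mul_right f (hx y y.2) (hx y' y'.2)]; rfl
    rw [← Subgroup.map_subtype_commutator] at hzL
    obtain ⟨y, hy, rfl⟩ := hzL
    exact Abelianization.commutator_subset_ker θ hy
  have hzA := inf_commutator_le_inf H K hz
  obtain ⟨h, hh, k, hk, rfl⟩ := exists_mul_eq_of_sup_eq_top H K hprod g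
  have h1 := cocycle_comm_mul_left f (hcomm h hh z hzA.2) (hcomm z hzA.1 k hk).symm
  rw [key K h (fun y hy => hcomm h hh y hy) hz.2,
    key H k (fun y hy => (hcomm y hy k hk).symm) hz.1, add_zero] at h1
  exact (sub_eq_zero.1 h1).symm

theorem quotInclusion_injective (A : Subgroup G) [A.Normal] [(A.subgroupOf H).Normal] :
    Function.Injective (quotInclusion H A) := by
  refine (injective_iff_map_eq_one _).2 fun x hx => ?_
  obtain ⟨h, rfl⟩ := QuotientGroup.mk_surjective x
  exact (QuotientGroup.eq_one_iff h).2 ((QuotientGroup.eq_one_iff (h : G)).1 hx)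

theorem quotProj_surjective {N M : Subgroup G} [N.Normal] [M.Normal] (h : N ≤ M) :
    Function.Surjective (quotProj h) := fun q => by
  obtain ⟨x, rfl⟩ := QuotientGroup.mk_surjective q
  exact ⟨QuotientGroup.mk x, rfl⟩

theorem quotProj_eq_one_iff_mem_range (A B : Subgroup G) [A.Normal] (hA : A ≤ B)
    (hB : B = H ⊓ K) [(A.subgroupOf H).Normal] [(A.subgroupOf K).Normal]
    [(B.subgroupOf H).Normal] (x : H ⧸ A.subgroupOf H) :
    quotProj (subgroupOf_le hA H) x = 1 ↔ quotInclusion H A x ∈ (quotInclusion K A).range := by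
  subst hB
  obtain ⟨h, rfl⟩ := QuotientGroup.mk_surjective x
  refine (QuotientGroup.eq_one_iff h).trans ⟨fun hh => ⟨QuotientGroup.mk ⟨h, hh.2⟩, rfl⟩, ?_⟩
  rintro ⟨y, hy⟩
  obtain ⟨k, rfl⟩ := QuotientGroup.mk_surjective y
  have h1 : (k : G)⁻¹ * h ∈ A := QuotientGroup.eq.1 hy
  have h2 := K.mul_mem k.2 (hA h1).2
  rw [mul_inv_cancel_left] at h2
  exact ⟨h.2, h2⟩

theorem exists_mem_commutator_of_mem_quotient (A : Subgroup G) [(A.subgroupOf H).Normal]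
    {x : H ⧸ A.subgroupOf H} (hx : x ∈ commutator (H ⧸ A.subgroupOf H)) :
    ∃ h : H, (h : G) ∈ ⁅H, H⁆ ∧ QuotientGroup.mk h = x := by
  rw [commutator_def, ← Subgroup.map_top_of_surjective (QuotientGroup.mk' (A.subgroupOf H))
    (QuotientGroup.mk'_surjective _), ← Subgroup.map_commutator] at hx
  obtain ⟨h, hh, rfl⟩ := hx
  refine ⟨h, ?_, rfl⟩
  rw [← Subgroup.map_subtype_commutator]
  exact ⟨h, hh, rfl⟩

end Subgroups

/-- If the inflation maps `H²(H/A, D) → H²(H/Z, D)` and `H²(K/A, D) → H²(K/Z, D)`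
are surjective, then `H²(G, D) ≅ ((H²(H/Z, D) ⊕ H²(K/Z, D))/N) ⊕ Hom(H/A ⊗ K/A, D)`
for a subgroup `N ≅ Hom(Z, D)`. -/
theorem h2_iso_of_inflations_surjective {G : Type} [Group G] (H K : Subgroup G) [H.Normal] [K.Normal]
    (hprod : H ⊔ K = ⊤) (hcomm : ∀ h ∈ H, ∀ k ∈ K, Commute h k)
    (D : Type) [AddCommGroup D] [DivisibleBy D ℤ]
    [((H ⊓ K).subgroupOf H).Normal] [((H ⊓ K).subgroupOf K).Normal]
    [((⁅H, H⁆ ⊓ ⁅K, K⁆).subgroupOf H).Normal] [((⁅H, H⁆ ⊓ ⁅K, K⁆).subgroupOf K).Normal]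
    (hinfH : Function.Surjective
      (inflMap (subgroupOf_le (inf_commutator_le_inf H K) H) D))
    (hinfK : Function.Surjective
      (inflMap (subgroupOf_le (inf_commutator_le_inf H K) K) D)) :
    ∃ N : AddSubgroup
        (H2 (↥H ⧸ (⁅H, H⁆ ⊓ ⁅K, K⁆).subgroupOf H) D ×
         H2 (↥K ⧸ (⁅H, H⁆ ⊓ ⁅K, K⁆).subgroupOf K) D),
      Nonempty (↥N ≃+ (Additive ↥(⁅H, H⁆ ⊓ ⁅K, K⁆) →+ D)) ∧
      Nonempty (H2 G D ≃+
        (((H2 (↥H ⧸ (⁅H, H⁆ ⊓ ⁅K, K⁆).subgroupOf H) D ×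
           H2 (↥K ⧸ (⁅H, H⁆ ⊓ ⁅K, K⁆).subgroupOf K) D) ⧸ N) ×
         (AbTensor (↥H ⧸ (H ⊓ K).subgroupOf H) (↥K ⧸ (H ⊓ K).subgroupOf K) →+ D))) := by
  have hle := inf_commutator_le_inf H K
  have hc : ∀ m ∈ (QuotientGroup.mk' (⁅H, H⁆ ⊓ ⁅K, K⁆)).ker, ∀ p, Commute m p := fun m hm p =>
    commute_of_mem_inf H K hprod hcomm (hle (by rwa [QuotientGroup.ker_mk'] at hm)) p
  have hπ := QuotientGroup.mk'_surjective (⁅H, H⁆ ⊓ ⁅K, K⁆)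
  let inf : H2 (G ⧸ ⁅H, H⁆ ⊓ ⁅K, K⁆) D →+ H2 G D := H2Map (QuotientGroup.mk' (⁅H, H⁆ ⊓ ⁅K, K⁆))
  have hinf : Function.Surjective inf := fun c => by
    obtain ⟨f, rfl⟩ := H2mk_surjective c
    obtain ⟨g, hg⟩ := exists_pullback_of_symmetric _ hπ hc f fun m hm p =>
      cocycle_symm_of_mem_commutator_inf H K hprod hcomm f
        (by rwa [QuotientGroup.ker_mk'] at hm) p
    exact ⟨H2mk g, hg⟩
  let i := quotInclusion H (⁅H, H⁆ ⊓ ⁅K, K⁆)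
  let j := quotInclusion K (⁅H, H⁆ ⊓ ⁅K, K⁆)
  have hi : Function.Injective i := quotInclusion_injective H _
  have hj : Function.Injective j := quotInclusion_injective K _
  have hij : ∀ x y, Commute (i x) (j y) := fun x y => by
    obtain ⟨h, rfl⟩ := QuotientGroup.mk_surjective x
    obtain ⟨k, rfl⟩ := QuotientGroup.mk_surjective y
    exact (hcomm h h.2 k k.2).map (QuotientGroup.mk' (⁅H, H⁆ ⊓ ⁅K, K⁆))
  have hprod' : Function.Surjective (i.noncommCoprod j hij) := fun q => by
    obtain ⟨g, rfl⟩ := QuotientGroup.mk_surjective q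
    obtain ⟨h, hh, k, hk, rfl⟩ := exists_mul_eq_of_sup_eq_top H K hprod g
    exact ⟨(QuotientGroup.mk ⟨h, hh⟩, QuotientGroup.mk ⟨k, hk⟩), rfl⟩
  let u := quotProj (subgroupOf_le hle H)
  let v := quotProj (subgroupOf_le hle K)
  have hu : ∀ x, u x = 1 ↔ i x ∈ j.range := quotProj_eq_one_iff_mem_range H K _ _ hle rfl
  have hv : ∀ y, v y = 1 ↔ j y ∈ i.range :=
    quotProj_eq_one_iff_mem_range K H _ _ hle (inf_comm H K)
  have hcomm' : ∀ x ∈ commutator _, ∀ y ∈ commutator _, i x * j y = 1 → x = 1 := by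
    intro x hx y hy hxy
    obtain ⟨h, hh, rfl⟩ := exists_mem_commutator_of_mem_quotient H _ hx
    obtain ⟨k, hk, rfl⟩ := exists_mem_commutator_of_mem_quotient K _ hy
    have h1 : (h : G) * k ∈ ⁅H, H⁆ ⊓ ⁅K, K⁆ := (QuotientGroup.eq_one_iff (h * k : G)).1 hxy
    refine (QuotientGroup.eq_one_iff h).2 ⟨hh, ?_⟩
    have h2 := Subgroup.mul_mem _ h1.2 (Subgroup.inv_mem _ hk)
    rwa [mul_inv_cancel_right] at h2
  let β : H2 (G ⧸ ⁅H, H⁆ ⊓ ⁅K, K⁆) D →+ pairings u v D :=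
    (commPairing i j hij).codRestrict _
      (commPairing_mem_pairings i j hij hi hj u v hu hv hinfH hinfK)
  obtain ⟨N, ⟨eN⟩, ⟨e⟩⟩ := exists_quotient_prod_equiv inf hinf
    ((H2Map i).prod (H2Map j)) β
    ⟨(injective_iff_map_eq_zero _).2 fun c hc => eq_zero_of_restrictions_eq_zero i j hij hj hprod'
        hcomm' c (congrArg (fun t => t.1.1) hc) (congrArg (fun t => t.1.2) hc)
        (congrArg (fun t => t.2.1) hc),
      fun ⟨⟨a, b⟩, p⟩ => by
        obtain ⟨c, rfl, rfl, h⟩ :=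
          exists_of_restrictions i j hij hi hj hprod' u v hu hv hinfH hinfK a b p p.2
        exact ⟨c, Prod.ext rfl (Subtype.ext h)⟩⟩
    (fun c hc => Subtype.ext (by
      funext x y
      obtain ⟨h, rfl⟩ := QuotientGroup.mk_surjective x
      obtain ⟨k, rfl⟩ := QuotientGroup.mk_surjective y
      obtain ⟨f, rfl⟩ := H2mk_surjective c
      have h1 : commPairing H.subtype K.subtype (fun h k => hcomm h h.2 k k.2)
        (inf (H2mk f)) h k = 0 := by rw [hc, map_zero]; rfl
      exact h1))
  obtain ⟨eZ⟩ := nonempty_ker_H2Map_equiv (D := D) _ hπ hc (by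
    rw [QuotientGroup.ker_mk']
    exact inf_le_left.trans (Subgroup.commutator_mono le_top le_top))
  have eT := AddEquiv.ofBijective _ (tensorPairing_bijective (D := D) u v
    (quotProj_surjective _) (quotProj_surjective _))
  have eK : (Additive (QuotientGroup.mk' (⁅H, H⁆ ⊓ ⁅K, K⁆)).ker →+ D) ≃+
      (Additive ↥(⁅H, H⁆ ⊓ ⁅K, K⁆) →+ D) := by
    rw [QuotientGroup.ker_mk']
  exact ⟨N, ⟨eN.trans (eZ.trans eK)⟩, ⟨e.trans ((AddEquiv.refl _).prodCongr eT.symm)⟩⟩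

end SchurCP
end
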